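/- Let σ > 1, 2 ≤ q̃ ≤ ∞, 2 < q < ∞ and 6 < r ≤ r̃ < ∞ satisfy 1/q̃ + 3/r̃ > 3/2 − σ and 1/q + 3/r = 1/2, and let q̃′, q′, r̃′, r′ denote the conjugate exponents (1/q̃ + 1/q̃′ = 1, etc.). Then there exists a constant C > 0 such that for every Schwartz function F : ℝ³ × ℝ → ℂ one has ‖ (x,t) ↦ ∫_ℝ ∫_{ℝ³} K_{2σ}(x−z, t−s) F(z,s) dz ds ‖_{W(q̃,q)_t W(r̃,r)_x} ≤ C ‖F‖_{W(q̃′,q′)_t W(r̃′,r′)_x}. -/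

import Mathlib

open MeasureTheory Real Complex

noncomputable section

/-- `⟨ξ⟩ = √(1+|ξ|²)`. -/
def jap (ξ : EuclideanSpace ℝ (Fin 3)) : ℝ := Real.sqrt (1 + ‖ξ‖ ^ 2)

/-- The dot product `x·ξ` on `ℝ³`. -/
def dotE (x ξ : EuclideanSpace ℝ (Fin 3)) : ℝ := ∑ i, x i * ξ i

/-- The Littlewood–Paley cutoff `χ_k(ξ) = ρ(2^{-(k+1)}|ξ|) - ρ(2^{-(k-2)}|ξ|)`. -/
def chiLP (ρ : ℝ → ℝ) (k : ℤ) (ξ : EuclideanSpace ℝ (Fin 3)) : ℝ :=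
  ρ ((2 : ℝ) ^ (-(k + 1)) * ‖ξ‖) - ρ ((2 : ℝ) ^ (-(k - 2)) * ‖ξ‖)

/-- The localized kernel `K_γ^k(x,t) = ∫ e^{ix·ξ} e^{it⟨ξ⟩} ⟨ξ⟩^{-γ} χ_k(ξ) dξ`. -/
def Kloc (ρ : ℝ → ℝ) (γ : ℝ) (k : ℤ) (x : EuclideanSpace ℝ (Fin 3)) (t : ℝ) : ℂ :=
  ∫ ξ : EuclideanSpace ℝ (Fin 3),
    Complex.exp (I * ((dotE x ξ : ℝ) + (t : ℝ) * jap ξ)) * ((jap ξ ^ (-γ) * chiLP ρ k ξ : ℝ) : ℂ)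

/-- The kernel `K_γ(x,t) = Σ_{k ∈ ℤ} K_γ^k(x,t)`. -/
def Kker (ρ : ℝ → ℝ) (γ : ℝ) (x : EuclideanSpace ℝ (Fin 3)) (t : ℝ) : ℂ :=
  ∑' k : ℤ, Kloc ρ γ k x t

/-- The Euclidean norm `|(x,t)|` of `(x,t) ∈ ℝ³ × ℝ = ℝ⁴`. -/
def xtNorm (x : EuclideanSpace ℝ (Fin 3)) (t : ℝ) : ℝ := Real.sqrt (‖x‖ ^ 2 + t ^ 2)
open scoped ENNReal NNReal

/-- The `L^p` norm (with `p ∈ [1,∞]`) of an `ℝ≥0∞`-valued function. -/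
def LpE {α : Type*} [MeasurableSpace α] (μ : MeasureTheory.Measure α) (p : ℝ≥0∞)
    (f : α → ℝ≥0∞) : ℝ≥0∞ :=
  if p = ∞ then essSup f μ else (∫⁻ a, f a ^ p.toReal ∂μ) ^ (1 / p.toReal)

/-- The Wiener amalgam norm `‖g‖_{W(p',p)}` on `ℝ³` with window `ψ`,
applied to the pointwise magnitude `g : ℝ³ → ℝ≥0∞` of a function. -/
def WAx (ψ : EuclideanSpace ℝ (Fin 3) → ℝ) (p' p : ℝ≥0∞)
    (g : EuclideanSpace ℝ (Fin 3) → ℝ≥0∞) : ℝ≥0∞ :=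
  LpE MeasureTheory.volume p
    (fun y => LpE MeasureTheory.volume p' (fun x => g x * ‖ψ (x - y)‖₊))

/-- The mixed Wiener amalgam norm `‖u‖_{W(q̃,q)_t W(r̃,r)_x}` with windows `ψ`, `φ`. -/
def WAmix (ψ : EuclideanSpace ℝ (Fin 3) → ℝ) (φ : ℝ → ℝ) (qt q rt r : ℝ≥0∞)
    (F : EuclideanSpace ℝ (Fin 3) × ℝ → ℂ) : ℝ≥0∞ :=
  LpE MeasureTheory.volume q (fun s : ℝ =>
    LpE MeasureTheory.volume qt (fun t : ℝ =>
      WAx ψ rt r (fun x => (‖F (x, t)‖₊ : ℝ≥0∞)) * ‖φ (t - s)‖₊))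

/-- Real-exponent `L^p` norm of an `ℝ≥0∞`-valued function. -/
def NP {α : Type*} [MeasurableSpace α] (μ : Measure α) (p : ℝ) (f : α → ℝ≥0∞) : ℝ≥0∞ :=
  (∫⁻ a, f a ^ p ∂μ) ^ (1 / p)

lemma NP_mono {α : Type*} [MeasurableSpace α] {μ : Measure α} {p : ℝ} (hp : 0 < p)
    {f g : α → ℝ≥0∞} (h : ∀ x, f x ≤ g x) : NP μ p f ≤ NP μ p g := by
  unfold NP
  gcongr with x
  exact h x

lemma NP_mono_ae {α : Type*} [MeasurableSpace α] {μ : Measure α} {p : ℝ} (hp : 0 < p)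
    {f g : α → ℝ≥0∞} (h : ∀ᵐ x ∂μ, f x ≤ g x) : NP μ p f ≤ NP μ p g := by
  unfold NP
  refine ENNReal.rpow_le_rpow (lintegral_mono_ae ?_) (by positivity)
  filter_upwards [h] with x hx
  exact ENNReal.rpow_le_rpow hx hp.le

lemma NP_const_mul {α : Type*} [MeasurableSpace α] {μ : Measure α} {p : ℝ} (hp : 0 < p)
    {f : α → ℝ≥0∞} {c : ℝ≥0∞} (hc : c ≠ ∞) : NP μ p (fun x => c * f x) = c * NP μ p f := by
  unfold NP
  simp_rw [ENNReal.mul_rpow_of_nonneg _ _ hp.le]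
  rw [lintegral_const_mul' _ _ (ENNReal.rpow_ne_top_of_nonneg hp.le hc),
    ENNReal.mul_rpow_of_nonneg _ _ (by positivity), ← ENNReal.rpow_mul,
    mul_one_div_cancel hp.ne', ENNReal.rpow_one]

lemma NP_add_le {α : Type*} [MeasurableSpace α] {μ : Measure α} {p : ℝ} (hp : 1 ≤ p)
    {f g : α → ℝ≥0∞} (hf : AEMeasurable f μ) (hg : AEMeasurable g μ) :
    NP μ p (fun x => f x + g x) ≤ NP μ p f + NP μ p g :=
  ENNReal.lintegral_Lp_add_le hf hg hp

lemma LpE_ofReal {α : Type*} [MeasurableSpace α] {μ : Measure α} {p : ℝ} (hp : 0 ≤ p)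
    (f : α → ℝ≥0∞) : LpE μ (ENNReal.ofReal p) f = NP μ p f := by
  unfold LpE NP
  simp [ENNReal.toReal_ofReal hp]

/-- Duality characterisation (upper bound). -/
lemma dual_bound {α : Type*} [MeasurableSpace α] {μ : Measure α} [SigmaFinite μ] {p q : ℝ}
    (hpq : p.HolderConjugate q) {u : α → ℝ≥0∞} (hu : Measurable u) {A : ℝ≥0∞}
    (H : ∀ h : α → ℝ≥0∞, Measurable h → ∫⁻ x, h x * u x ∂μ ≤ A * NP μ q h) :
    NP μ p u ≤ A := by
  classical
  have hp : 0 < p := hpq.pos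
  have hq : 0 < q := hpq.symm.pos
  set v : ℕ → α → ℝ≥0∞ := fun n => (spanningSets μ n).indicator (fun x => min (u x) n) with hv
  have hvm : ∀ n, Measurable (v n) := fun n =>
    (hu.min measurable_const).indicator (measurableSet_spanningSets μ n)
  have hvu : ∀ n x, v n x ≤ u x := by
    intro n x
    simp only [hv, Set.indicator_apply]
    split_ifs
    · exact min_le_left _ _
    · exact zero_le
  have hfin : ∀ n, ∫⁻ x, v n x ^ p ∂μ < ∞ := by
    intro n
    calc ∫⁻ x, v n x ^ p ∂μ ≤ ∫⁻ x, (spanningSets μ n).indicator (fun _ => (n : ℝ≥0∞) ^ p) x ∂μ := by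
          apply lintegral_mono
          intro x
          simp only [hv, Set.indicator_apply]
          split_ifs
          · exact ENNReal.rpow_le_rpow (min_le_right _ _) hp.le
          · simp [hp]
      _ = (n : ℝ≥0∞) ^ p * μ (spanningSets μ n) := by
          rw [lintegral_indicator_const (measurableSet_spanningSets μ n)]
      _ < ∞ := ENNReal.mul_lt_top (ENNReal.rpow_lt_top_of_nonneg hp.le (by simp))
          (measure_spanningSets_lt_top μ n)
  have key : ∀ n, ∫⁻ x, v n x ^ p ∂μ ≤ A ^ p := by
    intro n
    set I := ∫⁻ x, v n x ^ p ∂μ with hI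
    have h1 : I ≤ A * I ^ (1 / q) := by
      have h2 := H (fun x => v n x ^ (p - 1)) ((hvm n).pow_const _)
      have h3 : NP μ q (fun x => v n x ^ (p - 1)) = I ^ (1 / q) := by
        unfold NP
        simp_rw [← ENNReal.rpow_mul, hpq.sub_one_mul_conj]
        rfl
      rw [h3] at h2
      refine le_trans ?_ h2
      apply lintegral_mono
      intro x
      calc v n x ^ p = v n x ^ (p - 1) * v n x := by
            by_cases h0 : v n x = 0
            · simp [h0, hp]
            · have ht : v n x ≠ ∞ := by
                simp only [hv, Set.indicator_apply]
                split_ifs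
                · exact ((min_le_right _ _).trans_lt (by simp)).ne
                · simp
              nth_rewrite 3 [← ENNReal.rpow_one (v n x)]
              rw [← ENNReal.rpow_add _ _ h0 ht]
              ring_nf
        _ ≤ _ := mul_le_mul_right (hvu n x) _
    by_cases h0 : I = 0
    · simp [h0]
    have hIt : I ≠ ∞ := (hfin n).ne
    have h4 : I ^ (1 / p) * I ^ (1 / q) ≤ A * I ^ (1 / q) := by
      rw [← ENNReal.rpow_add _ _ h0 hIt]
      have : 1 / p + 1 / q = 1 := by
        have := hpq.inv_add_inv_eq_one
        simpa [one_div] using this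
      rw [this, ENNReal.rpow_one]
      exact h1
    have h5 : I ^ (1 / p) ≤ A := by
      refine (ENNReal.mul_le_mul_iff_left ?_ ?_).1 h4
      · simp [h0, hIt]
      · exact ENNReal.rpow_ne_top_of_nonneg (by positivity) hIt
    calc I = (I ^ (1 / p)) ^ p := by
          rw [← ENNReal.rpow_mul, one_div_mul_cancel hp.ne', ENNReal.rpow_one]
      _ ≤ _ := ENNReal.rpow_le_rpow h5 hp.le
  have hlim : ∫⁻ x, u x ^ p ∂μ ≤ A ^ p := by
    have ht : Filter.Tendsto (fun n => ∫⁻ x, v n x ^ p ∂μ) Filter.atTop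
        (nhds (∫⁻ x, u x ^ p ∂μ)) := by
      apply lintegral_tendsto_of_tendsto_of_monotone
      · exact fun n => ((hvm n).pow_const _).aemeasurable
      · refine Filter.Eventually.of_forall fun x n m hnm => ?_
        refine ENNReal.rpow_le_rpow ?_ hp.le
        simp only [hv, Set.indicator_apply]
        by_cases h1 : x ∈ spanningSets μ n
        · have h2 : x ∈ spanningSets μ m := monotone_spanningSets μ hnm h1
          simp only [h1, h2, if_true]
          gcongr
        · simp [h1]
      · refine Filter.Eventually.of_forall fun x => ?_
        refine (ENNReal.continuous_rpow_const.tendsto _).comp ?_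
        have h1 : ∀ᶠ n in Filter.atTop, x ∈ spanningSets μ n := by
          filter_upwards [Filter.eventually_ge_atTop (spanningSetsIndex μ x)] with n hn
          exact monotone_spanningSets μ hn (mem_spanningSetsIndex μ x)
        have h2 : Filter.Tendsto (fun n : ℕ => min (u x) (n : ℝ≥0∞)) Filter.atTop
            (nhds (min (u x) ∞)) :=
          Filter.Tendsto.min tendsto_const_nhds ENNReal.tendsto_nat_nhds_top
        rw [min_eq_left le_top] at h2
        refine h2.congr' ?_
        filter_upwards [h1] with n hn
        simp [hv, hn]
    exact le_of_tendsto' ht key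
  unfold NP
  calc (∫⁻ x, u x ^ p ∂μ) ^ (1 / p) ≤ (A ^ p) ^ (1 / p) :=
        ENNReal.rpow_le_rpow hlim (by positivity)
    _ = A := by rw [← ENNReal.rpow_mul, mul_one_div_cancel hp.ne', ENNReal.rpow_one]

/-- Hölder in `NP` form. -/
lemma NP_holder {α : Type*} [MeasurableSpace α] {μ : Measure α} {p q : ℝ}
    (hpq : p.HolderConjugate q) {f g : α → ℝ≥0∞} (hf : Measurable f) (hg : Measurable g) :
    ∫⁻ x, f x * g x ∂μ ≤ NP μ p f * NP μ q g :=
  ENNReal.lintegral_mul_le_Lp_mul_Lq μ hpq hf.aemeasurable hg.aemeasurable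

lemma NP_measurable {α β : Type*} [MeasurableSpace α] [MeasurableSpace β] {μ : Measure α}
    [SFinite μ] {p : ℝ} {f : α → β → ℝ≥0∞} (hf : Measurable (Function.uncurry f)) :
    Measurable (fun w => NP μ p (fun x => f x w)) := by
  unfold NP
  refine Measurable.pow_const ?_ _
  exact Measurable.lintegral_prod_left (f := fun x w => f x w ^ p) (hf.pow_const p)

/-- Minkowski's integral inequality. -/
lemma NP_minkowski {α β : Type*} [MeasurableSpace α] [MeasurableSpace β] {μ : Measure α}
    {ν : Measure β} [SigmaFinite μ] [SFinite ν] {p : ℝ} (hp : 1 ≤ p) {f : α → β → ℝ≥0∞}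
    (hf : Measurable (Function.uncurry f)) :
    NP μ p (fun x => ∫⁻ w, f x w ∂ν) ≤ ∫⁻ w, NP μ p (fun x => f x w) ∂ν := by
  rcases hp.eq_or_lt with rfl | hp
  · unfold NP
    simp only [ENNReal.rpow_one, div_one]
    rw [lintegral_lintegral_swap hf.aemeasurable]
  · have hpq := Real.HolderConjugate.conjExponent hp
    set q := p.conjExponent
    have hum : Measurable (fun x => ∫⁻ w, f x w ∂ν) := hf.lintegral_prod_right
    refine dual_bound hpq hum ?_
    intro h hh
    calc ∫⁻ x, h x * ∫⁻ w, f x w ∂ν ∂μ = ∫⁻ x, ∫⁻ w, h x * f x w ∂ν ∂μ := by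
          congr 1; ext x
          rw [lintegral_const_mul]
          exact hf.of_uncurry_left
      _ = ∫⁻ w, ∫⁻ x, h x * f x w ∂μ ∂ν := by
          rw [lintegral_lintegral_swap]
          exact ((hh.comp measurable_fst).mul hf).aemeasurable
      _ ≤ ∫⁻ w, NP μ p (fun x => f x w) * NP μ q h ∂ν := by
          apply lintegral_mono
          intro w
          simp only
          rw [mul_comm]
          exact NP_holder hpq.symm hh hf.of_uncurry_right
      _ = (∫⁻ w, NP μ p (fun x => f x w) ∂ν) * NP μ q h := by
          rw [lintegral_mul_const _ (NP_measurable hf)]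

/-- Self-dual Young/Schur inequality. -/
lemma NP_young {α β : Type*} [MeasurableSpace α] [MeasurableSpace β] {μ : Measure α}
    {ν : Measure β} [SigmaFinite μ] [SFinite ν] {p q : ℝ} (hp : 2 ≤ p)
    (hpq : p.HolderConjugate q) {K : α → β → ℝ≥0∞} (hK : Measurable (Function.uncurry K))
    {g : β → ℝ≥0∞} (hg : Measurable g) {D : ℝ≥0∞}
    (h1 : ∀ x, ∫⁻ z, K x z ^ (p / 2) ∂ν ≤ D) (h2 : ∀ z, ∫⁻ x, K x z ^ (p / 2) ∂μ ≤ D) :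
    NP μ p (fun x => ∫⁻ z, K x z * g z ∂ν) ≤ D ^ (2 / p) * NP ν q g := by
  have hp0 : 0 < p := by linarith
  have hq0 : 0 < q := hpq.symm.pos
  have hinv : 1 / p + 1 / q = 1 := by
    have := hpq.inv_add_inv_eq_one
    simpa [one_div] using this
  have hqp : q * (1 / p) + q * (1 - 2 / p) = 1 := by
    have : q * (1 / q) = 1 := by field_simp
    have h3 : 1 / q = 1 - 1 / p := by linarith
    rw [h3] at this
    linear_combination this
  have hw : 0 ≤ 1 - 2 / p := by
    rw [sub_nonneg, div_le_one hp0]; exact hp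
  set G := ∫⁻ z, g z ^ q ∂ν with hG
  have hpt : ∀ x, (∫⁻ z, K x z * g z ∂ν) ^ p ≤
      (∫⁻ z, K x z ^ (p / 2) * g z ^ q ∂ν) * (D * G ^ (p - 2)) := by
    intro x
    have hKx : Measurable (K x) := hK.of_uncurry_left
    have hh := ENNReal.lintegral_prod_norm_pow_le (μ := ν) (Finset.univ : Finset (Fin 3))
      (f := ![fun z => K x z ^ (p / 2) * g z ^ q, fun z => K x z ^ (p / 2), fun z => g z ^ q])
      (p := ![1 / p, 1 / p, 1 - 2 / p]) (by
        intro i _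
        fin_cases i
        · exact ((hKx.pow_const _).mul (hg.pow_const _)).aemeasurable
        · exact (hKx.pow_const _).aemeasurable
        · exact (hg.pow_const _).aemeasurable) (by
        simp [Fin.sum_univ_three]; ring) (by
        intro i _
        fin_cases i
        · simp; positivity
        · simp; positivity
        · simpa using hw)
    simp only [Fin.prod_univ_three, Matrix.cons_val_zero, Matrix.cons_val_one,
      Matrix.cons_val_two, Matrix.head_cons, Matrix.tail_cons] at hh
    have e1 : ∀ z, (K x z ^ (p / 2) * g z ^ q) ^ (1 / p) * (K x z ^ (p / 2)) ^ (1 / p) *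
        (g z ^ q) ^ (1 - 2 / p) = K x z * g z := by
      intro z
      rw [ENNReal.mul_rpow_of_nonneg _ _ (by positivity), ← ENNReal.rpow_mul, ← ENNReal.rpow_mul,
        ← ENNReal.rpow_mul]
      have e2 : p / 2 * (1 / p) = 1 / 2 := by field_simp
      rw [e2]
      calc K x z ^ (1 / 2 : ℝ) * g z ^ (q * (1 / p)) * K x z ^ (1 / 2 : ℝ) * g z ^ (q * (1 - 2 / p))
          = (K x z ^ (1 / 2 : ℝ) * K x z ^ (1 / 2 : ℝ)) *
            (g z ^ (q * (1 / p)) * g z ^ (q * (1 - 2 / p))) := by ring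
        _ = K x z * g z := by
          rw [← ENNReal.rpow_add_of_nonneg _ _ (by norm_num) (by norm_num),
            ← ENNReal.rpow_add_of_nonneg _ _ (by positivity) (by positivity), hqp]
          norm_num
    simp_rw [e1] at hh
    calc (∫⁻ z, K x z * g z ∂ν) ^ p
        ≤ ((∫⁻ z, K x z ^ (p / 2) * g z ^ q ∂ν) ^ (1 / p) *
          (∫⁻ z, K x z ^ (p / 2) ∂ν) ^ (1 / p) * G ^ (1 - 2 / p)) ^ p :=
          ENNReal.rpow_le_rpow hh hp0.le
      _ = (∫⁻ z, K x z ^ (p / 2) * g z ^ q ∂ν) *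
          ((∫⁻ z, K x z ^ (p / 2) ∂ν) * G ^ (p - 2)) := by
          rw [ENNReal.mul_rpow_of_nonneg _ _ hp0.le, ENNReal.mul_rpow_of_nonneg _ _ hp0.le,
            ← ENNReal.rpow_mul, ← ENNReal.rpow_mul, ← ENNReal.rpow_mul,
            one_div_mul_cancel hp0.ne', ENNReal.rpow_one, ENNReal.rpow_one, mul_assoc]
          congr 3
          field_simp
      _ ≤ _ := by gcongr; exact h1 x
  unfold NP
  calc (∫⁻ x, (∫⁻ z, K x z * g z ∂ν) ^ p ∂μ) ^ (1 / p)
      ≤ (∫⁻ x, (∫⁻ z, K x z ^ (p / 2) * g z ^ q ∂ν) * (D * G ^ (p - 2)) ∂μ) ^ (1 / p) := by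
        gcongr with x
        exact hpt x
    _ = ((∫⁻ z, (∫⁻ x, K x z ^ (p / 2) ∂μ) * g z ^ q ∂ν) * (D * G ^ (p - 2))) ^ (1 / p) := by
        rw [lintegral_mul_const _ (by
          exact Measurable.lintegral_prod_right (f := fun x z => K x z ^ (p / 2) * g z ^ q)
            ((hK.pow_const _).mul ((hg.comp measurable_snd).pow_const _)))]
        rw [lintegral_lintegral_swap (by
          exact ((hK.pow_const _).mul ((hg.comp measurable_snd).pow_const _)).aemeasurable)]
        congr 3
        ext z
        rw [lintegral_mul_const _ (hK.of_uncurry_right.pow_const _)]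
    _ ≤ ((∫⁻ z, D * g z ^ q ∂ν) * (D * G ^ (p - 2))) ^ (1 / p) := by
        gcongr with z
        exact h2 z
    _ = D ^ (2 / p) * G ^ (1 / q) := by
        rw [lintegral_const_mul _ (hg.pow_const _)]
        calc (D * G * (D * G ^ (p - 2))) ^ (1 / p)
            = (D ^ (2 : ℝ) * G ^ (p - 1)) ^ (1 / p) := by
              congr 1
              calc D * G * (D * G ^ (p - 2)) = (D * D) * (G * G ^ (p - 2)) := by ring
                _ = _ := by
                  congr 1
                  · rw [ENNReal.rpow_two, sq]
                  · nth_rewrite 1 [← ENNReal.rpow_one G]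
                    rw [← ENNReal.rpow_add_of_nonneg _ _ (by norm_num) (by linarith)]
                    ring_nf
          _ = D ^ (2 / p) * G ^ (1 / q) := by
              rw [ENNReal.mul_rpow_of_nonneg _ _ (by positivity), ← ENNReal.rpow_mul,
                ← ENNReal.rpow_mul]
              have e3 : (p - 1) * (1 / p) = 1 / q := by
                have h3 : 1 / q = 1 - 1 / p := by linarith
                rw [h3]; field_simp
              rw [e3]
              congr 2
              ring

section scaling
variable {E : Type*} [NormedAddCommGroup E] [NormedSpace ℝ E] [FiniteDimensional ℝ E]
  [MeasurableSpace E] [BorelSpace E]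

lemma lint_scale (μ : Measure E) [μ.IsAddHaarMeasure] {T : ℝ} (hT : 0 < T) {f : E → ℝ≥0∞}
    (hf : Measurable f) :
    ∫⁻ x, f x ∂μ = ENNReal.ofReal T ^ (Module.finrank ℝ E : ℝ) * ∫⁻ x, f (T • x) ∂μ := by
  have h1 : ∫⁻ x, f (T • x) ∂μ = ∫⁻ x, f x ∂(Measure.map (T • ·) μ) := by
    rw [lintegral_map hf (measurable_const_smul T)]
  rw [h1, Measure.map_addHaar_smul μ hT.ne', lintegral_smul_measure, smul_eq_mul, ← mul_assoc]
  have : ENNReal.ofReal T ^ (Module.finrank ℝ E : ℝ) *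
      ENNReal.ofReal |(T ^ Module.finrank ℝ E)⁻¹| = 1 := by
    rw [abs_of_pos (by positivity), ENNReal.rpow_natCast, ← ENNReal.ofReal_pow hT.le,
      ← ENNReal.ofReal_mul (by positivity), mul_inv_cancel₀ (by positivity), ENNReal.ofReal_one]
  rw [this, one_mul]

/-- Local integrability of `‖x‖^(-s)`, `s < dim`. -/
lemma lint_ball_rpow (μ : Measure E) [μ.IsAddHaarMeasure] (hd : 1 ≤ Module.finrank ℝ E) {s R : ℝ}
    (hs0 : 0 ≤ s) (hs : s < Module.finrank ℝ E) :
    ∫⁻ x, (Metric.ball (0 : E) R).indicator (fun x => ‖x‖ₑ ^ (-s)) x ∂μ < ∞ := by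
  have hnt : Nontrivial E := Module.nontrivial_of_finrank_pos (R := ℝ) (by omega)
  have h1 : IntegrableOn (fun x : E => ‖x‖ ^ (-s)) (Metric.ball 0 R) μ := by
    apply integrableOn_ball_of_norm_le_rpow hd (C := 1) hs
    · refine Filter.Eventually.of_forall fun x => ?_
      rw [one_mul, Real.norm_of_nonneg (by positivity)]
    · exact (by fun_prop : Measurable fun x : E => ‖x‖ ^ (-s)).aestronglyMeasurable
  have h2 := h1.2
  rw [hasFiniteIntegral_iff_enorm] at h2
  rw [lintegral_indicator measurableSet_ball]
  refine lt_of_le_of_lt (le_of_eq ?_) h2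
  apply lintegral_congr_ae
  have h3 : ∀ᵐ x ∂μ, x ≠ 0 := by
    simp [ae_iff, measure_singleton]
  filter_upwards [ae_restrict_of_ae h3] with x hx
  have hx' : 0 < ‖x‖ := norm_pos_iff.2 hx
  rw [Real.enorm_of_nonneg (by positivity), ← ENNReal.ofReal_rpow_of_pos hx', ofReal_norm]

lemma lint_far_rpow (μ : Measure E) [μ.IsAddHaarMeasure] {s : ℝ} (hs0 : 0 ≤ s)
    (hs : Module.finrank ℝ E < s) :
    ∫⁻ x, ENNReal.ofReal (1 + ‖x‖) ^ (-s) ∂μ < ∞ := by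
  refine lt_of_le_of_lt (le_of_eq ?_) (finite_integral_one_add_norm (μ := μ) hs)
  congr 1; ext x
  rw [ENNReal.ofReal_rpow_of_pos (by positivity)]

end scaling

lemma hls_J1 {l : ℝ} (h0 : 0 < l) (h1 : l < 1) : ∃ c : ℝ≥0∞, c ≠ ∞ ∧ ∀ R : ℝ, 0 < R →
    ∫⁻ x : ℝ, (Metric.ball (0 : ℝ) R).indicator (fun x => ‖x‖ₑ ^ (-l)) x
      ≤ c * ENNReal.ofReal R ^ (1 - l) := by
  refine ⟨∫⁻ x : ℝ, (Metric.ball (0 : ℝ) 1).indicator (fun x => ‖x‖ₑ ^ (-l)) x, ?_, ?_⟩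
  · exact (lint_ball_rpow volume (by simp) h0.le (by simpa using h1)).ne
  · intro R hR
    have hm : Measurable (fun x : ℝ => ‖x‖ₑ ^ (-l)) := by fun_prop
    rw [lint_scale volume hR (hm.indicator measurableSet_ball)]
    have hR0 : ENNReal.ofReal R ≠ 0 := by simpa using hR
    have e : ∀ x : ℝ, (Metric.ball (0 : ℝ) R).indicator (fun x => ‖x‖ₑ ^ (-l)) (R • x) =
        ENNReal.ofReal R ^ (-l) * (Metric.ball (0 : ℝ) 1).indicator (fun x => ‖x‖ₑ ^ (-l)) x := by
      intro x
      classical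
      simp only [Set.indicator_apply, Metric.mem_ball, dist_zero_right, norm_smul,
        Real.norm_of_nonneg hR.le]
      have : R * ‖x‖ < R ↔ ‖x‖ < 1 := by
        constructor
        · intro h; by_contra h'; push Not at h'; nlinarith
        · intro h; nlinarith
      simp only [this]
      split_ifs
      · rw [enorm_smul, ENNReal.mul_rpow_of_ne_top (by simp) (by simp), Real.enorm_of_nonneg hR.le]
      · simp
    simp_rw [e]
    rw [lintegral_const_mul _ (hm.indicator measurableSet_ball), ← mul_assoc,
      ← ENNReal.rpow_add _ _ hR0 (by simp)]
    simp only [Module.finrank_self, Nat.cast_one]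
    rw [mul_comm, sub_eq_add_neg]

lemma hls_J2 : ∃ c : ℝ≥0∞, c ≠ ∞ ∧ ∀ R : ℝ, 0 < R →
    ∫⁻ x : ℝ, ((Metric.ball (0 : ℝ) R)ᶜ).indicator (fun x => ‖x‖ₑ ^ (-2 : ℝ)) x
      ≤ c * ENNReal.ofReal R ^ (-1 : ℝ) := by
  have hm : Measurable (fun x : ℝ => ‖x‖ₑ ^ (-2 : ℝ)) := by fun_prop
  refine ⟨∫⁻ x : ℝ, ((Metric.ball (0 : ℝ) 1)ᶜ).indicator (fun x => ‖x‖ₑ ^ (-2 : ℝ)) x, ?_, ?_⟩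
  · have h1 : ∫⁻ x : ℝ, (4 : ℝ≥0∞) * ENNReal.ofReal (1 + ‖x‖) ^ (-2 : ℝ) < ∞ := by
      rw [lintegral_const_mul _ (by fun_prop)]
      exact ENNReal.mul_lt_top (by simp) (lint_far_rpow volume (by norm_num) (by simp))
    refine (lt_of_le_of_lt (lintegral_mono fun x => ?_) h1).ne
    classical
    simp only [Set.indicator_apply]
    split_ifs with h
    · have hx : 1 ≤ ‖x‖ := by simpa using h
      have hx0 : 0 < ‖x‖ := by linarith
      rw [← ofReal_norm, ENNReal.ofReal_rpow_of_pos hx0, ENNReal.ofReal_rpow_of_pos (by positivity)]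
      rw [show (4 : ℝ≥0∞) = ENNReal.ofReal 4 by simp, ← ENNReal.ofReal_mul (by norm_num)]
      apply ENNReal.ofReal_le_ofReal
      rw [Real.rpow_neg (by positivity), Real.rpow_neg (by positivity), Real.rpow_two,
        Real.rpow_two, ← div_eq_mul_inv, inv_eq_one_div, div_le_div_iff₀ (by positivity) (by positivity)]
      nlinarith
    · exact zero_le
  · intro R hR
    have hmi := hm.indicator (measurableSet_ball (x := (0 : ℝ)) (ε := R)).compl
    have hmi1 := hm.indicator (measurableSet_ball (x := (0 : ℝ)) (ε := 1)).compl
    rw [lint_scale volume hR hmi]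
    have hR0 : ENNReal.ofReal R ≠ 0 := by simpa using hR
    have e : ∀ x : ℝ, ((Metric.ball (0 : ℝ) R)ᶜ).indicator (fun x => ‖x‖ₑ ^ (-2 : ℝ)) (R • x) =
        ENNReal.ofReal R ^ (-2 : ℝ) *
          ((Metric.ball (0 : ℝ) 1)ᶜ).indicator (fun x => ‖x‖ₑ ^ (-2 : ℝ)) x := by
      intro x
      classical
      simp only [Set.indicator_apply, Set.mem_compl_iff, Metric.mem_ball, dist_zero_right, norm_smul,
        Real.norm_of_nonneg hR.le]
      have : R * ‖x‖ < R ↔ ‖x‖ < 1 := by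
        constructor
        · intro h; by_contra h'; push Not at h'; nlinarith
        · intro h; nlinarith
      simp only [this]
      split_ifs
      · simp
      · rw [enorm_smul, ENNReal.mul_rpow_of_ne_top (by simp) (by simp), Real.enorm_of_nonneg hR.le]
    simp_rw [e]
    rw [lintegral_const_mul _ hmi1, ← mul_assoc, ← ENNReal.rpow_add _ _ hR0 (by simp)]
    simp only [Module.finrank_self, Nat.cast_one]
    rw [mul_comm]
    norm_num

/-- The key quadratic estimate behind HLS. -/
lemma hls_inner {l p q : ℝ} (h0 : 0 < l) (h1 : l < 1) (hq : q = 2 / l)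
    (hpq : p.HolderConjugate q) : ∃ c : ℝ≥0∞, c ≠ ∞ ∧ ∀ f : ℝ → ℝ≥0∞, Measurable f →
      ∀ A : ℝ≥0∞, A ≠ 0 → A ≠ ∞ → ∀ s : ℝ,
      ∫⁻ t, min (f t) A * ‖s - t‖ₑ ^ (-l) ≤ c * (1 + NP volume p f) * A ^ (p - 1) := by
  obtain ⟨c1, hc1, H1⟩ := hls_J1 h0 h1
  obtain ⟨c2, hc2, H2⟩ := hls_J2
  have hp0 : 0 < p := hpq.pos
  have hq0 : 0 < q := hpq.symm.pos
  have hinv : 1 / p + 1 / q = 1 := by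
    have := hpq.inv_add_inv_eq_one
    simpa [one_div] using this
  have h1q : 1 / q = l / 2 := by rw [hq]; field_simp
  have hpl : p * (1 - l / 2) = 1 := by
    rw [← h1q, show 1 - 1 / q = 1 / p by linarith]; field_simp
  refine ⟨c1 + c2 ^ (1 / q), by
    simp [hc1, hc2, h0, h1, hq0, ENNReal.rpow_eq_top_iff]; intro; positivity, ?_⟩
  intro f hf A hA0 hAt s
  set R := (A ^ (-p)).toReal with hR
  have hAp0 : A ^ (-p) ≠ 0 := by simp [ENNReal.rpow_eq_zero_iff, hA0, hAt]
  have hApt : A ^ (-p) ≠ ∞ := by simp [ENNReal.rpow_eq_top_iff, hA0, hAt]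
  have hRpos : 0 < R := ENNReal.toReal_pos hAp0 hApt
  have hRA : ENNReal.ofReal R = A ^ (-p) := ENNReal.ofReal_toReal hApt
  have hm : Measurable (fun x : ℝ => ‖x‖ₑ ^ (-l)) := by fun_prop
  set k1 := (Metric.ball (0 : ℝ) R).indicator (fun x => ‖x‖ₑ ^ (-l)) with hk1
  set k2 := ((Metric.ball (0 : ℝ) R)ᶜ).indicator (fun x => ‖x‖ₑ ^ (-l)) with hk2
  have hk1m : Measurable k1 := hm.indicator measurableSet_ball
  have hk2m : Measurable k2 := hm.indicator measurableSet_ball.compl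
  have hk : ∀ x, ‖x‖ₑ ^ (-l) = k1 x + k2 x := by
    intro x
    rw [hk1, hk2, Set.indicator_self_add_compl_apply]
  have hst : Measurable (fun t : ℝ => s - t) := by fun_prop
  have hk1s : Measurable (fun t => k1 (s - t)) := hk1m.comp hst
  have hk2s : Measurable (fun t => k2 (s - t)) := hk2m.comp hst
  have hb1 : ∫⁻ t, A * k1 (s - t) ≤ c1 * A ^ (p - 1) := by
    rw [lintegral_const_mul _ hk1s, lintegral_sub_left_eq_self k1 s]
    calc A * ∫⁻ x, k1 x ≤ A * (c1 * ENNReal.ofReal R ^ (1 - l)) := by gcongr; exact H1 R hRpos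
      _ = c1 * (A ^ (1 : ℝ) * A ^ (-p * (1 - l))) := by
        rw [hRA, ← ENNReal.rpow_mul, ENNReal.rpow_one]; ring
      _ = c1 * A ^ (p - 1) := by
        rw [← ENNReal.rpow_add _ _ hA0 hAt]
        congr 2
        linear_combination -2 * hpl
  have hb2 : ∫⁻ t, f t * k2 (s - t) ≤ c2 ^ (1 / q) * NP volume p f * A ^ (p - 1) := by
    refine (NP_holder hpq hf hk2s).trans ?_
    have : NP volume q (fun t => k2 (s - t)) ≤ c2 ^ (1 / q) * A ^ (p - 1) := by
      unfold NP
      rw [lintegral_sub_left_eq_self (fun x => k2 x ^ q) s]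
      have e : ∀ x, k2 x ^ q = ((Metric.ball (0 : ℝ) R)ᶜ).indicator (fun x => ‖x‖ₑ ^ (-2 : ℝ)) x := by
        intro x
        classical
        simp only [hk2, Set.indicator_apply]
        split_ifs
        · rw [← ENNReal.rpow_mul]
          congr 1
          rw [hq]; field_simp
        · simp [hq0]
      simp_rw [e]
      calc _ ≤ (c2 * ENNReal.ofReal R ^ (-1 : ℝ)) ^ (1 / q) :=
            ENNReal.rpow_le_rpow (H2 R hRpos) (by positivity)
        _ = c2 ^ (1 / q) * A ^ (-p * -1 * (1 / q)) := by
            rw [ENNReal.mul_rpow_of_nonneg _ _ (by positivity), hRA, ENNReal.rpow_mul A,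
              ENNReal.rpow_mul A]
        _ = c2 ^ (1 / q) * A ^ (p - 1) := by
            congr 2
            rw [h1q]
            linear_combination -hpl
    calc _ ≤ NP volume p f * (c2 ^ (1 / q) * A ^ (p - 1)) := by gcongr
      _ = _ := by ring
  calc ∫⁻ t, min (f t) A * ‖s - t‖ₑ ^ (-l)
      ≤ ∫⁻ t, (A * k1 (s - t) + f t * k2 (s - t)) := by
        apply lintegral_mono
        intro t
        simp only
        rw [hk, mul_add]
        gcongr
        · exact min_le_right _ _
        · exact min_le_left _ _
    _ = (∫⁻ t, A * k1 (s - t)) + ∫⁻ t, f t * k2 (s - t) := by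
        rw [lintegral_add_left]
        exact hk1s.const_mul A
    _ ≤ c1 * A ^ (p - 1) + c2 ^ (1 / q) * NP volume p f * A ^ (p - 1) := add_le_add hb1 hb2
    _ = (c1 * 1 + c2 ^ (1 / q) * NP volume p f) * A ^ (p - 1) := by ring
    _ ≤ ((c1 + c2 ^ (1 / q)) * 1 + (c1 + c2 ^ (1 / q)) * NP volume p f) * A ^ (p - 1) := by
        gcongr
        · exact le_self_add
        · exact le_add_self
    _ = _ := by ring

lemma hls_quad {l p q : ℝ} (h0 : 0 < l) (h1 : l < 1) (hq : q = 2 / l)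
    (hpq : p.HolderConjugate q) : ∃ c : ℝ≥0∞, c ≠ ∞ ∧ ∀ f : ℝ → ℝ≥0∞, Measurable f →
      ∫⁻ t, f t ^ p ≠ ∞ →
      ∫⁻ s, f s * ∫⁻ t, ‖s - t‖ₑ ^ (-l) * f t ≤ c * (1 + NP volume p f) * ∫⁻ t, f t ^ p := by
  obtain ⟨c, hc, H⟩ := hls_inner h0 h1 hq hpq
  have hp0 : 0 < p := hpq.pos
  have hp1 : 1 < p := hpq.lt
  refine ⟨2 * c, ENNReal.mul_ne_top (by simp) hc, ?_⟩
  intro f hf hfin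
  have hfae : ∀ᵐ s, f s < ∞ := by
    have := ae_lt_top (hf.pow_const p) hfin
    filter_upwards [this] with s hs
    by_contra h
    simp only [not_lt, top_le_iff] at h
    rw [h, ENNReal.top_rpow_of_pos hp0] at hs
    exact lt_irrefl _ hs
  have hkm : Measurable (fun z : ℝ × ℝ => ‖z.1 - z.2‖ₑ ^ (-l)) := by fun_prop
  have hf1 : Measurable (fun z : ℝ × ℝ => f z.1) := hf.comp measurable_fst
  have hf2 : Measurable (fun z : ℝ × ℝ => f z.2) := hf.comp measurable_snd
  set P : ℝ → ℝ → ℝ≥0∞ := fun s t => f s * (min (f t) (f s) * ‖s - t‖ₑ ^ (-l)) with hP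
  have hPm : Measurable (Function.uncurry P) := hf1.mul ((hf2.min hf1).mul hkm)
  have hmain : ∫⁻ s, ∫⁻ t, P s t ≤ c * (1 + NP volume p f) * ∫⁻ t, f t ^ p := by
    calc ∫⁻ s, ∫⁻ t, P s t ≤ ∫⁻ s, c * (1 + NP volume p f) * f s ^ p := by
          apply lintegral_mono_ae
          filter_upwards [hfae] with s hs
          simp only [hP]
          rw [lintegral_const_mul _ (by fun_prop)]
          by_cases hs0 : f s = 0
          · simp [hs0]
          calc f s * ∫⁻ t, min (f t) (f s) * ‖s - t‖ₑ ^ (-l)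
              ≤ f s * (c * (1 + NP volume p f) * f s ^ (p - 1)) := by
                gcongr
                exact H f hf (f s) hs0 hs.ne s
            _ = c * (1 + NP volume p f) * (f s ^ (1 : ℝ) * f s ^ (p - 1)) := by
                rw [ENNReal.rpow_one]; ring
            _ = _ := by
                rw [← ENNReal.rpow_add _ _ hs0 hs.ne]
                ring_nf
      _ = _ := by rw [lintegral_const_mul _ (hf.pow_const p)]
  calc ∫⁻ s, f s * ∫⁻ t, ‖s - t‖ₑ ^ (-l) * f t
      = ∫⁻ s, ∫⁻ t, f s * (‖s - t‖ₑ ^ (-l) * f t) := by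
        congr 1; ext s
        rw [lintegral_const_mul _ (by fun_prop)]
    _ ≤ ∫⁻ s, ∫⁻ t, (P s t + P t s) := by
        refine lintegral_mono fun s => lintegral_mono fun t => ?_
        simp only [hP]
        rcases le_total (f s) (f t) with h | h
        · refine le_trans (le_of_eq ?_) le_add_self
          rw [min_eq_left h, enorm_sub_rev]
          ring
        · refine le_trans (le_of_eq ?_) le_self_add
          rw [min_eq_left h]
          ring
    _ = (∫⁻ s, ∫⁻ t, P s t) + ∫⁻ s, ∫⁻ t, P t s := by
        rw [← lintegral_add_left hPm.lintegral_prod_right]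
        congr 1; ext s
        rw [lintegral_add_left hPm.of_uncurry_left]
    _ = (∫⁻ s, ∫⁻ t, P s t) + ∫⁻ s, ∫⁻ t, P s t := by
        rw [lintegral_lintegral_swap (f := fun s t => P t s)
          (hPm.comp measurable_swap).aemeasurable]
    _ ≤ _ := by
        refine (add_le_add hmain hmain).trans (le_of_eq ?_)
        ring

lemma hls_bil {l p q : ℝ} (h0 : 0 < l) (h1 : l < 1) (hq : q = 2 / l)
    (hpq : p.HolderConjugate q) : ∃ c : ℝ≥0∞, c ≠ ∞ ∧ ∀ f h : ℝ → ℝ≥0∞, Measurable f →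
      Measurable h → NP volume p f ≤ 1 → NP volume p h ≤ 1 →
      ∫⁻ s, h s * ∫⁻ t, ‖s - t‖ₑ ^ (-l) * f t ≤ c := by
  obtain ⟨c, hc, H⟩ := hls_quad h0 h1 hq hpq
  have hp0 : 0 < p := hpq.pos
  refine ⟨c * (1 + 2) * 2 ^ p, ?_, ?_⟩
  · refine ENNReal.mul_ne_top (ENNReal.mul_ne_top hc (by simp)) ?_
    exact ENNReal.rpow_ne_top_of_nonneg hp0.le (by simp)
  intro f h hf hh hf1 hh1
  set g : ℝ → ℝ≥0∞ := fun x => f x + h x with hg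
  have hgm : Measurable g := hf.add hh
  have hgN : NP volume p g ≤ 2 := by
    refine (NP_add_le hpq.lt.le hf.aemeasurable hh.aemeasurable).trans ?_
    refine (add_le_add hf1 hh1).trans (by norm_num)
  have hgI : ∫⁻ t, g t ^ p ≤ 2 ^ p := by
    have := ENNReal.rpow_le_rpow hgN hp0.le
    unfold NP at this
    rwa [← ENNReal.rpow_mul, one_div_mul_cancel hp0.ne', ENNReal.rpow_one] at this
  have hgt : ∫⁻ t, g t ^ p ≠ ∞ :=
    (hgI.trans_lt (ENNReal.rpow_lt_top_of_nonneg hp0.le (by simp))).ne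
  calc ∫⁻ s, h s * ∫⁻ t, ‖s - t‖ₑ ^ (-l) * f t
      ≤ ∫⁻ s, g s * ∫⁻ t, ‖s - t‖ₑ ^ (-l) * g t := by
        gcongr with s t
        · exact le_add_self
        · exact le_self_add
    _ ≤ c * (1 + NP volume p g) * ∫⁻ t, g t ^ p := H g hgm hgt
    _ ≤ _ := by gcongr

/-- Diagonal Hardy–Littlewood–Sobolev inequality on `ℝ`. -/
lemma hls {l p q : ℝ} (h0 : 0 < l) (h1 : l < 1) (hq : q = 2 / l)
    (hpq : p.HolderConjugate q) : ∃ c : ℝ≥0∞, c ≠ ∞ ∧ ∀ f : ℝ → ℝ≥0∞, Measurable f →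
      NP volume q (fun s => ∫⁻ t, ‖s - t‖ₑ ^ (-l) * f t) ≤ c * NP volume p f := by
  obtain ⟨c, hc, H⟩ := hls_bil h0 h1 hq hpq
  have hp0 : 0 < p := hpq.pos
  refine ⟨c + 1, by simp [hc], ?_⟩
  intro f hf
  have hkm : Measurable (fun z : ℝ × ℝ => ‖z.1 - z.2‖ₑ ^ (-l)) := by fun_prop
  have hum : Measurable (fun s => ∫⁻ t, ‖s - t‖ₑ ^ (-l) * f t) :=
    Measurable.lintegral_prod_right (f := fun s t => ‖s - t‖ₑ ^ (-l) * f t)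
      (hkm.mul (hf.comp measurable_snd))
  refine dual_bound hpq.symm hum ?_
  intro h hh
  have hhu : Measurable (fun s => h s * ∫⁻ t, ‖s - t‖ₑ ^ (-l) * f t) := hh.mul hum
  have zero_ae : ∀ g : ℝ → ℝ≥0∞, Measurable g → NP volume p g = 0 → ∀ᵐ x, g x = 0 := by
    intro g hg hg0
    unfold NP at hg0
    rw [ENNReal.rpow_eq_zero_iff_of_pos (by positivity)] at hg0
    exact ENNReal.ae_eq_zero_of_lintegral_rpow_eq_zero hp0.le hg.aemeasurable hg0
  by_cases hf0 : NP volume p f = 0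
  · have hf' := zero_ae f hf hf0
    have : ∀ s, ∫⁻ t, ‖s - t‖ₑ ^ (-l) * f t = 0 := by
      intro s
      rw [lintegral_eq_zero_iff (by fun_prop)]
      filter_upwards [hf'] with t ht
      simp [ht]
    simp [this]
  by_cases hh0 : NP volume p h = 0
  · have hh' := zero_ae h hh hh0
    have : ∫⁻ s, h s * ∫⁻ t, ‖s - t‖ₑ ^ (-l) * f t = 0 := by
      rw [lintegral_eq_zero_iff hhu]
      filter_upwards [hh'] with t ht
      simp [ht]
    rw [this]; exact zero_le
  by_cases hft : NP volume p f = ∞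
  · rw [hft, ENNReal.mul_top (by simp), ENNReal.top_mul hh0]; exact le_top
  by_cases hht : NP volume p h = ∞
  · rw [hht, ENNReal.mul_top]
    · exact le_top
    · simp [hf0]
  set a := NP volume p f with ha
  set b := NP volume p h with hb
  have hai : a⁻¹ ≠ ∞ := ENNReal.inv_ne_top.2 hf0
  have hbi : b⁻¹ ≠ ∞ := ENNReal.inv_ne_top.2 hh0
  have key := H (fun x => a⁻¹ * f x) (fun x => b⁻¹ * h x) (hf.const_mul _) (hh.const_mul _)
    (by rw [NP_const_mul hp0 hai, ENNReal.inv_mul_cancel hf0 hft])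
    (by rw [NP_const_mul hp0 hbi, ENNReal.inv_mul_cancel hh0 hht])
  have e : ∫⁻ s, b⁻¹ * h s * ∫⁻ t, ‖s - t‖ₑ ^ (-l) * (a⁻¹ * f t) =
      a⁻¹ * b⁻¹ * ∫⁻ s, h s * ∫⁻ t, ‖s - t‖ₑ ^ (-l) * f t := by
    rw [← lintegral_const_mul _ hhu]
    congr 1; ext s
    have : ∫⁻ t, ‖s - t‖ₑ ^ (-l) * (a⁻¹ * f t) = a⁻¹ * ∫⁻ t, ‖s - t‖ₑ ^ (-l) * f t := by
      rw [← lintegral_const_mul _ (by fun_prop)]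
      congr 1; ext t; ring
    rw [this]; ring
  rw [e] at key
  set I := ∫⁻ s, h s * ∫⁻ t, ‖s - t‖ₑ ^ (-l) * f t
  calc I = (a * a⁻¹) * (b * b⁻¹) * I := by
        rw [ENNReal.mul_inv_cancel hf0 hft, ENNReal.mul_inv_cancel hh0 hht]; simp
    _ = a * b * (a⁻¹ * b⁻¹ * I) := by ring
    _ ≤ a * b * c := by gcongr
    _ ≤ a * b * (c + 1) := by gcongr; exact le_self_add
    _ = _ := by ring

section amalgam
variable {E : Type*} [NormedAddCommGroup E] [NormedSpace ℝ E] [FiniteDimensional ℝ E]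
  [MeasurableSpace E] [BorelSpace E]

/-- Two-sided bound for a window. -/
lemma window_bounds {ψ : E → ℝ} (hc : Continuous ψ) (hs : HasCompactSupport ψ) (h0 : ∃ x, ψ x ≠ 0) :
    ∃ (x0 : E) (δ ρ : ℝ) (c M : ℝ≥0∞), 0 < δ ∧ 0 < ρ ∧ c ≠ 0 ∧ c ≠ ∞ ∧ M ≠ ∞ ∧
      (∀ x ∈ Metric.ball x0 δ, c ≤ (‖ψ x‖₊ : ℝ≥0∞)) ∧
      (∀ x, (‖ψ x‖₊ : ℝ≥0∞) ≤ M) ∧ (∀ x, x ∉ Metric.ball (0 : E) ρ → ψ x = 0) := by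
  obtain ⟨x0, hx0⟩ := h0
  have hpos : 0 < ‖ψ x0‖₊ := by simpa using hx0
  have hev : ∀ᶠ x in nhds x0, ‖ψ x0‖₊ / 2 < ‖ψ x‖₊ :=
    (hc.nnnorm.tendsto x0).eventually (lt_mem_nhds (half_lt_self hpos))
  obtain ⟨δ, hδ, hball⟩ := Metric.eventually_nhds_iff_ball.1 hev
  obtain ⟨M, hM⟩ := hs.exists_bound_of_continuous hc
  obtain ⟨ρ, hρ⟩ := (hs.isCompact.isBounded).subset_ball (0 : E)
  refine ⟨x0, δ, max ρ 1, ((‖ψ x0‖₊ / 2 : ℝ≥0) : ℝ≥0∞), ENNReal.ofReal M, hδ, by positivity, ?_, ENNReal.coe_ne_top,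
    by simp, ?_, ?_, ?_⟩
  · simpa using hx0
  · intro x hx
    exact_mod_cast (hball x hx).le
  · intro x
    rw [← enorm_eq_nnnorm, ← ofReal_norm]
    exact ENNReal.ofReal_le_ofReal (hM x)
  · intro x hx
    by_contra h
    apply hx
    have := hρ (subset_tsupport ψ (Function.mem_support.2 h))
    exact Metric.ball_subset_ball (le_max_left _ _) this

/-- decomposition of a convolution over balls -/
lemma conv_decomp (μ : Measure E) [μ.IsAddHaarMeasure] {δ : ℝ} (hδ : 0 < δ) {κ f : E → ℝ≥0∞}
    (hκ : Measurable κ) (hf : Measurable f) (x : E) :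
    ∫⁻ z, κ (x - z) * f z ∂μ = (μ (Metric.ball (0 : E) δ))⁻¹ *
      ∫⁻ w, ∫⁻ z, κ (x - z) * (Metric.ball w δ).indicator f z ∂μ ∂μ := by
  classical
  have hV0 : μ (Metric.ball (0 : E) δ) ≠ 0 := (Metric.measure_ball_pos μ 0 hδ).ne'
  have hVt : μ (Metric.ball (0 : E) δ) ≠ ∞ := measure_ball_lt_top.ne
  have hset : MeasurableSet {p : E × E | p.2 ∈ Metric.ball p.1 δ} := by
    simp only [Metric.mem_ball]
    exact measurableSet_lt (by fun_prop) measurable_const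
  have hm : Measurable (Function.uncurry fun w z : E =>
      κ (x - z) * (Metric.ball w δ).indicator f z) := by
    have h1 : Measurable (fun p : E × E => {p : E × E | p.2 ∈ Metric.ball p.1 δ}.indicator
      (fun p => f p.2) p) := (hf.comp measurable_snd).indicator hset
    have h2 : Measurable (fun p : E × E => κ (x - p.2)) := hκ.comp (by fun_prop)
    exact h2.mul h1
  rw [lintegral_lintegral_swap hm.aemeasurable]
  have e : ∀ z, ∫⁻ w, κ (x - z) * (Metric.ball w δ).indicator f z ∂μ =
      μ (Metric.ball (0 : E) δ) * (κ (x - z) * f z) := by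
    intro z
    have : ∀ w, κ (x - z) * (Metric.ball w δ).indicator f z =
        (Metric.ball z δ).indicator (fun _ => κ (x - z) * f z) w := by
      intro w
      simp only [Set.indicator_apply, Metric.mem_ball, dist_comm z w]
      split_ifs <;> simp
    simp_rw [this]
    rw [lintegral_indicator measurableSet_ball, setLIntegral_const,
      Measure.addHaar_ball_center μ z, mul_comm]
  simp_rw [e]
  have h2 : Measurable (fun z : E => κ (x - z) * f z) := (hκ.comp (by fun_prop)).mul hf
  rw [lintegral_const_mul _ h2, ← mul_assoc, ENNReal.inv_mul_cancel hV0 hVt, one_mul]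

lemma ballind_meas {δ : ℝ} {f : E → ℝ≥0∞} (hf : Measurable f) :
    Measurable (Function.uncurry fun z w : E => (Metric.ball w δ).indicator f z) := by
  have hset : MeasurableSet {p : E × E | p.1 ∈ Metric.ball p.2 δ} := by
    simp only [Metric.mem_ball]
    exact measurableSet_lt (by fun_prop) measurable_const
  exact (hf.comp measurable_fst).indicator hset

/-- local estimate, finite exponent -/
lemma AC_inner (μ : Measure E) [μ.IsAddHaarMeasure] {δ ρ pt pt' : ℝ} (hδ : 0 < δ)
    (hpt : 2 ≤ pt) (hpp : pt.HolderConjugate pt') {κ f Kt : E → ℝ≥0∞}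
    (hκ : Measurable κ) (hf : Measurable f)
    (hKt : ∀ v, NP μ (pt / 2) ((Metric.ball v (ρ + δ)).indicator κ) ≤ Kt v) (y : E) :
    NP μ pt ((Metric.ball y ρ).indicator (fun x => ∫⁻ z, κ (x - z) * f z ∂μ)) ≤
      (μ (Metric.ball (0 : E) δ))⁻¹ *
        ∫⁻ w, Kt (y - w) * NP μ pt' ((Metric.ball w δ).indicator f) ∂μ := by
  classical
  have hp0 : 0 < pt := by linarith
  have hV0 : μ (Metric.ball (0 : E) δ) ≠ 0 := (Metric.measure_ball_pos μ 0 hδ).ne'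
  set V := μ (Metric.ball (0 : E) δ)
  set kk : E → E → E → ℝ≥0∞ := fun w x z => (Metric.ball (y - w) (ρ + δ)).indicator κ (x - z)
  have hkkm : ∀ w, Measurable (Function.uncurry (kk w)) := fun w =>
    (hκ.indicator measurableSet_ball).comp (measurable_fst.sub measurable_snd)
  have hkk3 : Measurable (fun p : (E × E) × E => kk p.1.2 p.1.1 p.2) := by
    have hset : MeasurableSet {p : (E × E) × E | p.1.1 - p.2 ∈ Metric.ball (y - p.1.2) (ρ + δ)} := by
      simp only [Metric.mem_ball]
      exact measurableSet_lt (by fun_prop) measurable_const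
    exact (hκ.comp (by fun_prop : Measurable fun p : (E × E) × E => p.1.1 - p.2)).indicator hset
  have hfm := ballind_meas (δ := δ) hf
  have hint : Measurable (Function.uncurry fun x w =>
      ∫⁻ z, kk w x z * (Metric.ball w δ).indicator f z ∂μ) := by
    refine Measurable.lintegral_prod_right (f := fun (p : E × E) z =>
      kk p.2 p.1 z * (Metric.ball p.2 δ).indicator f z) ?_
    exact hkk3.mul (hfm.comp (by fun_prop : Measurable fun p : (E × E) × E => (p.2, p.1.2)))
  have step1 : ∀ x, (Metric.ball y ρ).indicator (fun x => ∫⁻ z, κ (x - z) * f z ∂μ) x ≤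
      V⁻¹ * ∫⁻ w, ∫⁻ z, kk w x z * (Metric.ball w δ).indicator f z ∂μ ∂μ := by
    intro x
    rw [Set.indicator_apply]
    split_ifs with hx
    · rw [conv_decomp μ hδ hκ hf x]
      refine mul_le_mul_right (lintegral_mono fun w => lintegral_mono fun z => ?_) _
      simp only [kk, Set.indicator_apply]
      by_cases hz : z ∈ Metric.ball w δ
      · have : x - z ∈ Metric.ball (y - w) (ρ + δ) := by
          rw [Metric.mem_ball, dist_eq_norm] at *
          calc ‖x - z - (y - w)‖ = ‖(x - y) - (z - w)‖ := by congr 1; abel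
            _ ≤ ‖x - y‖ + ‖z - w‖ := norm_sub_le _ _
            _ < ρ + δ := by linarith
        simp [this]
      · simp [hz]
    · exact zero_le
  refine (NP_mono hp0 step1).trans ?_
  rw [NP_const_mul hp0 (ENNReal.inv_ne_top.2 hV0)]
  gcongr
  refine (NP_minkowski (by linarith) hint).trans ?_
  refine lintegral_mono fun w => ?_
  have hfw : Measurable ((Metric.ball w δ).indicator f) := hf.indicator measurableSet_ball
  set D := ∫⁻ v, ((Metric.ball (y - w) (ρ + δ)).indicator κ v) ^ (pt / 2) ∂μ
  have := NP_young hpt hpp (hkkm w) hfw (D := D) (μ := μ) (ν := μ)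
    (fun x => (lintegral_sub_left_eq_self
      (fun v => ((Metric.ball (y - w) (ρ + δ)).indicator κ v) ^ (pt / 2)) x).le)
    (fun z => (lintegral_sub_right_eq_self
      (fun v => ((Metric.ball (y - w) (ρ + δ)).indicator κ v) ^ (pt / 2)) z).le)
  refine this.trans ?_
  gcongr
  refine le_trans (le_of_eq ?_) (hKt (y - w))
  unfold NP
  congr 1
  field_simp

lemma AC_inner_top (μ : Measure E) [μ.IsAddHaarMeasure] {δ ρ : ℝ} (hδ : 0 < δ)
    {κ f Kt : E → ℝ≥0∞} (hκ : Measurable κ) (hf : Measurable f) (hKtm : Measurable Kt)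
    (hKt : ∀ v, ∀ x ∈ Metric.ball v (ρ + δ), κ x ≤ Kt v) (y : E) :
    ∀ x ∈ Metric.ball y ρ, ∫⁻ z, κ (x - z) * f z ∂μ ≤
      (μ (Metric.ball (0 : E) δ))⁻¹ *
        ∫⁻ w, Kt (y - w) * NP μ 1 ((Metric.ball w δ).indicator f) ∂μ := by
  classical
  intro x hx
  rw [conv_decomp μ hδ hκ hf x]
  gcongr with w
  unfold NP
  simp only [ENNReal.rpow_one, div_one]
  have hfw : Measurable ((Metric.ball w δ).indicator f) := hf.indicator measurableSet_ball
  rw [← lintegral_const_mul _ hfw]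
  refine lintegral_mono fun z => ?_
  by_cases hz : z ∈ Metric.ball w δ
  · gcongr
    apply hKt
    rw [Metric.mem_ball, dist_eq_norm] at *
    calc ‖x - z - (y - w)‖ = ‖(x - y) - (z - w)‖ := by congr 1; abel
      _ ≤ ‖x - y‖ + ‖z - w‖ := norm_sub_le _ _
      _ < ρ + δ := by linarith
  · simp [Set.indicator_of_notMem hz]

/-- lower bound by the window -/
lemma window_lower (μ : Measure E) [μ.IsAddHaarMeasure] {ψ : E → ℝ} {x0 : E} {δ pt' p' : ℝ}
    (hpt' : 0 < pt') (hp' : 0 < p')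
    {c : ℝ≥0∞} (hc0 : c ≠ 0) (hct : c ≠ ∞)
    (h : ∀ x ∈ Metric.ball x0 δ, c ≤ (‖ψ x‖₊ : ℝ≥0∞)) (f : E → ℝ≥0∞) :
    NP μ p' (fun w => NP μ pt' ((Metric.ball w δ).indicator f)) ≤
      c⁻¹ * NP μ p' (fun y => NP μ pt' (fun x => f x * ‖ψ (x - y)‖₊)) := by
  classical
  have hci : c⁻¹ ≠ ∞ := ENNReal.inv_ne_top.2 hc0
  have h1 : ∀ w, NP μ pt' ((Metric.ball w δ).indicator f) ≤
      c⁻¹ * NP μ pt' (fun x => f x * ‖ψ (x - (w - x0))‖₊) := by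
    intro w
    rw [← NP_const_mul hpt' hci]
    refine NP_mono hpt' fun x => ?_
    rw [Set.indicator_apply]
    split_ifs with hx
    · have : c ≤ (‖ψ (x - (w - x0))‖₊ : ℝ≥0∞) := by
        apply h
        rw [Metric.mem_ball, dist_eq_norm] at *
        convert hx using 2
        abel
      calc f x = c⁻¹ * (f x * c) := by
            rw [mul_comm (f x), ← mul_assoc, ENNReal.inv_mul_cancel hc0 hct, one_mul]
        _ ≤ _ := by gcongr
    · exact zero_le
  refine (NP_mono hp' h1).trans ?_
  rw [NP_const_mul hp' hci]
  refine le_of_eq ?_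
  congr 1
  unfold NP
  rw [lintegral_sub_right_eq_self
    (fun y => ((∫⁻ x, (f x * ‖ψ (x - y)‖₊) ^ pt' ∂μ) ^ (1 / pt')) ^ p') x0]

/-- Amalgam convolution estimate. `R` depends only on the window. -/
lemma AC (μ : Measure E) [μ.IsAddHaarMeasure] {ψ : E → ℝ} (hc : Continuous ψ)
    (hs : HasCompactSupport ψ) (h0 : ∃ x, ψ x ≠ 0) :
    ∃ R : ℝ, 0 < R ∧ ∃ C : ℝ≥0∞, C ≠ ∞ ∧ ∀ (p p' : ℝ), 0 < p → 0 < p' →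
      ∀ (κ Kt f : E → ℝ≥0∞) (A : ℝ≥0∞), Measurable κ → Measurable Kt → Measurable f →
      (∀ G : E → ℝ≥0∞, Measurable G →
        NP μ p (fun y => ∫⁻ w, Kt (y - w) * G w ∂μ) ≤ A * NP μ p' G) →
      (∀ pt pt' : ℝ, 2 ≤ pt → pt.HolderConjugate pt' →
        (∀ v, NP μ (pt / 2) ((Metric.ball v R).indicator κ) ≤ Kt v) →
        NP μ p (fun y => NP μ pt (fun x => (∫⁻ z, κ (x - z) * f z ∂μ) * ‖ψ (x - y)‖₊)) ≤
          C * A * NP μ p' (fun y => NP μ pt' (fun x => f x * ‖ψ (x - y)‖₊))) ∧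
      ((∀ v, ∀ x ∈ Metric.ball v R, κ x ≤ Kt v) →
        NP μ p (fun y => essSup (fun x => (∫⁻ z, κ (x - z) * f z ∂μ) * ‖ψ (x - y)‖₊) μ) ≤
          C * A * NP μ p' (fun y => NP μ 1 (fun x => f x * ‖ψ (x - y)‖₊))) := by
  classical
  obtain ⟨x0, δ, ρ, c, M, hδ, hρ, hc0, hct, hM, hlow, hup, hsup⟩ := window_bounds hc hs h0
  have hV0 : μ (Metric.ball (0 : E) δ) ≠ 0 := (Metric.measure_ball_pos μ 0 hδ).ne'
  have hVi : (μ (Metric.ball (0 : E) δ))⁻¹ ≠ ∞ := ENNReal.inv_ne_top.2 hV0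
  set V := μ (Metric.ball (0 : E) δ)
  refine ⟨ρ + δ, by positivity, M * V⁻¹ * c⁻¹,
    ENNReal.mul_ne_top (ENNReal.mul_ne_top hM hVi) (ENNReal.inv_ne_top.2 hc0), ?_⟩
  intro p p' hp hp' κ Kt f A hκ hKtm hf hA
  have hpt : ∀ u : E → ℝ≥0∞, ∀ y x, u x * ‖ψ (x - y)‖₊ ≤ M * (Metric.ball y ρ).indicator u x := by
    intro u y x
    rw [Set.indicator_apply]
    split_ifs with hx
    · rw [mul_comm]
      gcongr
      exact hup _
    · have : ψ (x - y) = 0 := hsup _ (by simpa [dist_eq_norm] using hx)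
      simp [this]
  have fin : ∀ pt' : ℝ, 0 < pt' → ∀ N : E → ℝ≥0∞, (∀ y, N y ≤ M * (V⁻¹ *
        ∫⁻ w, Kt (y - w) * NP μ pt' ((Metric.ball w δ).indicator f) ∂μ)) →
      NP μ p N ≤ M * V⁻¹ * c⁻¹ * A * NP μ p' (fun y => NP μ pt' (fun x => f x * ‖ψ (x - y)‖₊)) := by
    intro pt' hpt' N hN
    refine (NP_mono hp hN).trans ?_
    rw [NP_const_mul hp hM, NP_const_mul hp hVi]
    calc _ ≤ M * (V⁻¹ * (A * NP μ p' (fun w => NP μ pt' ((Metric.ball w δ).indicator f)))) := by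
          gcongr
          exact hA _ (NP_measurable (ballind_meas hf))
      _ ≤ M * (V⁻¹ * (A * (c⁻¹ * NP μ p' (fun y => NP μ pt' (fun x => f x * ‖ψ (x - y)‖₊))))) := by
          gcongr
          exact window_lower μ hpt' hp' hc0 hct hlow f
      _ = _ := by ring
  constructor
  · intro pt pt' hpt2 hpp hKt
    have hpt0 : 0 < pt := by linarith
    refine fin pt' hpp.symm.pos _ fun y => ?_
    refine (NP_mono hpt0 (hpt _ y)).trans ?_
    rw [NP_const_mul hpt0 hM]
    gcongr
    exact AC_inner μ hδ hpt2 hpp hκ hf hKt y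
  · intro hKt
    refine fin 1 one_pos _ fun y => ?_
    refine essSup_le_of_ae_le _ (Filter.Eventually.of_forall fun x => ?_)
    refine (hpt (fun x => ∫⁻ z, κ (x - z) * f z ∂μ) y x).trans ?_
    simp only
    gcongr
    rw [Set.indicator_apply]
    split_ifs with hx
    · exact AC_inner_top μ hδ hκ hf hKtm hKt y x hx
    · exact zero_le
end amalgam

section radial

lemma rot_FT (x : EuclideanSpace ℝ (Fin 3)) (g : ℝ → ℂ) :
    ∫ ξ : EuclideanSpace ℝ (Fin 3), Complex.exp (I * (dotE x ξ : ℝ)) * g ‖ξ‖ =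
    ∫ ξ : EuclideanSpace ℝ (Fin 3), Complex.exp (I * ((‖x‖ * ξ 0 : ℝ) : ℂ)) * g ‖ξ‖ := by
  set e : EuclideanSpace ℝ (Fin 3) := EuclideanSpace.single 0 ‖x‖ with he
  have hn : ‖e‖ = ‖x‖ := by simp [he]
  set U := (Submodule.span ℝ {e - x})ᗮ.reflection with hU
  have hUe : U e = x := Submodule.reflection_sub hn
  have hd : ∀ y ξ : EuclideanSpace ℝ (Fin 3), dotE y ξ = inner ℝ y ξ := by
    intro y ξ
    simp [dotE, PiLp.inner_apply, mul_comm]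
  have hmp := U.measurePreserving
  have := hmp.integral_comp U.toHomeomorph.measurableEmbedding
    (fun ξ => Complex.exp (I * (dotE x ξ : ℝ)) * g ‖ξ‖)
  rw [← this]
  congr 1; ext ξ
  have h1 : dotE x (U ξ) = ‖x‖ * ξ 0 := by
    rw [hd, ← hUe, U.inner_map_map, he]
    simp [EuclideanSpace.inner_single_left]
  rw [h1, U.norm_map]

/-- splitting map -/
lemma split_mp : ∃ e : EuclideanSpace ℝ (Fin 3) ≃ᵐ ℝ × EuclideanSpace ℝ (Fin 2),
    MeasurePreserving e volume volume ∧ (∀ ξ, (e ξ).1 = ξ 0) ∧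
    ∀ ξ, ‖ξ‖ = Real.sqrt ((e ξ).1 ^ 2 + ‖(e ξ).2‖ ^ 2) := by
  let e1 := MeasurableEquiv.toLp 2 (Fin 3 → ℝ)
  let e2 := MeasurableEquiv.piFinSuccAbove (fun _ : Fin 3 => ℝ) 0
  let e3 := (MeasurableEquiv.refl ℝ).prodCongr (MeasurableEquiv.toLp 2 (Fin 2 → ℝ))
  refine ⟨(e1.symm.trans e2).trans e3, ?_, ?_, ?_⟩
  · have h1 : MeasurePreserving e1.symm volume volume := PiLp.volume_preserving_ofLp (Fin 3)
    have h2 : MeasurePreserving e2 volume volume := volume_preserving_piFinSuccAbove _ 0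
    have h3 : MeasurePreserving e3 volume volume :=
      (MeasurePreserving.id volume).prod (PiLp.volume_preserving_toLp (Fin 2))
    exact h3.comp (h2.comp h1)
  · intro ξ
    rfl
  · intro ξ
    rw [EuclideanSpace.norm_eq, EuclideanSpace.norm_eq, Real.sq_sqrt (by positivity)]
    congr 1
    rw [Fin.sum_univ_succ]
    simp only [Real.norm_eq_abs, sq_abs]
    rfl

lemma radial_FT : ∃ c : ℝ, ∀ (x : EuclideanSpace ℝ (Fin 3)) (g : ℝ → ℂ) (B : ℝ), 0 < B →
    Continuous g → (∀ w, g (-w) = g w) → (∀ w, B ≤ w → g w = 0) →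
    ∫ ξ : EuclideanSpace ℝ (Fin 3), Complex.exp (I * (dotE x ξ : ℝ)) * g ‖ξ‖ =
      (c : ℂ) * ∫ u in (-B)..B, Complex.exp (I * ((‖x‖ * u : ℝ) : ℂ)) *
        ∫ w in u..B, (w : ℂ) * g w := by
  refine ⟨2 * (volume : Measure (EuclideanSpace ℝ (Fin 2))).real (Metric.ball 0 1), ?_⟩
  intro x g B hB hg hev hsupp
  rw [rot_FT]
  obtain ⟨e, hmp, he1, he2⟩ := split_mp
  set X := ‖x‖
  set f : ℝ × EuclideanSpace ℝ (Fin 2) → ℂ := fun p =>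
    Complex.exp (I * ((X * p.1 : ℝ) : ℂ)) * g (Real.sqrt (p.1 ^ 2 + ‖p.2‖ ^ 2)) with hf
  have h1 : ∫ ξ : EuclideanSpace ℝ (Fin 3), Complex.exp (I * ((X * ξ 0 : ℝ) : ℂ)) * g ‖ξ‖ =
      ∫ p, f p := by
    rw [← hmp.integral_comp' f]
    congr 1; ext ξ
    simp only [hf]
    rw [← he2, he1]
  have hfc : Continuous f := by
    simp only [hf]
    fun_prop
  have hfs : HasCompactSupport f := by
    refine HasCompactSupport.intro (isCompact_closedBall (0 : ℝ × EuclideanSpace ℝ (Fin 2)) B) ?_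
    intro p hp
    simp only [Metric.mem_closedBall, dist_zero_right, not_le, Prod.norm_def, lt_max_iff] at hp
    simp only [hf]
    rw [hsupp, mul_zero]
    apply Real.le_sqrt_of_sq_le
    rcases hp with hp | hp
    · rw [Real.norm_eq_abs] at hp
      have : B ^ 2 ≤ |p.1| ^ 2 := by gcongr
      rw [sq_abs] at this
      nlinarith [sq_nonneg ‖p.2‖]
    · have : B ^ 2 ≤ ‖p.2‖ ^ 2 := by gcongr
      nlinarith [sq_nonneg p.1]
  have hfi : Integrable f (volume.prod volume) := hfc.integrable_of_hasCompactSupport hfs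
  set G : ℝ → ℂ := fun u => ∫ w in u..B, (w : ℂ) * g w with hG
  have hwg : Continuous (fun w : ℝ => (w : ℂ) * g w) := by fun_prop
  have hGd : ∀ u : ℝ, HasDerivAt G (-((u : ℂ) * g u)) u := fun u =>
    intervalIntegral.integral_hasDerivAt_left (hwg.intervalIntegrable _ _)
      (hwg.stronglyMeasurableAtFilter _ _) hwg.continuousAt
  have hGc : Continuous G := continuous_iff_continuousAt.2 fun u => (hGd u).continuousAt
  have hG0 : ∀ u, B ≤ u → G u = 0 := by
    intro u hu
    simp only [hG]
    rw [intervalIntegral.integral_symm, neg_eq_zero]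
    apply intervalIntegral.integral_zero_ae
    refine Filter.Eventually.of_forall fun w hw => ?_
    rw [Set.uIoc_of_le hu] at hw
    rw [hsupp w hw.1.le, mul_zero]
  have hGe : ∀ u, G (-u) = G u := by
    intro u
    have h2 : ∫ w in (-u)..u, (w : ℂ) * g w = 0 := by
      have := intervalIntegral.integral_comp_neg (a := -u) (b := u) (fun w : ℝ => (w : ℂ) * g w)
      simp only [hev, neg_neg, ofReal_neg, neg_mul, intervalIntegral.integral_neg] at this
      have h3 : (2 : ℂ) * ∫ w in (-u)..u, (w : ℂ) * g w = 0 := by linear_combination -this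
      simpa using h3
    simp only [hG]
    rw [← intervalIntegral.integral_add_adjacent_intervals (hwg.intervalIntegrable (-u) u)
      (hwg.intervalIntegrable u B), h2, zero_add]
  have hGabs : ∀ u, G |u| = G u := by
    intro u
    rcases abs_choice u with h | h <;> rw [h]
    exact hGe u
  have hinner : ∀ u : ℝ, ∫ v : EuclideanSpace ℝ (Fin 2), g (Real.sqrt (u ^ 2 + ‖v‖ ^ 2)) =
      ((2 * (volume : Measure (EuclideanSpace ℝ (Fin 2))).real (Metric.ball 0 1) : ℝ) : ℂ) * G u := by
    intro u
    rw [integral_fun_norm_addHaar volume (fun y => g (Real.sqrt (u ^ 2 + y ^ 2)))]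
    have hI : ∫ y in Set.Ioi (0 : ℝ), y ^ (Module.finrank ℝ (EuclideanSpace ℝ (Fin 2)) - 1) •
        g (Real.sqrt (u ^ 2 + y ^ 2)) = G u := by
      have hd : ∀ y ∈ Set.Ioi (0 : ℝ), HasDerivAt (fun y => - G (Real.sqrt (u ^ 2 + y ^ 2)))
          (y ^ (Module.finrank ℝ (EuclideanSpace ℝ (Fin 2)) - 1) •
            g (Real.sqrt (u ^ 2 + y ^ 2))) y := by
        intro y hy
        have hy : 0 < y := hy
        have hpos : 0 < u ^ 2 + y ^ 2 := by positivity
        have hs : 0 < Real.sqrt (u ^ 2 + y ^ 2) := Real.sqrt_pos.2 hpos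
        have h2 : HasDerivAt (fun y : ℝ => Real.sqrt (u ^ 2 + y ^ 2))
            (y / Real.sqrt (u ^ 2 + y ^ 2)) y := by
          have h3 : HasDerivAt (fun y : ℝ => u ^ 2 + y ^ 2) (2 * y) y := by
            simpa using (hasDerivAt_pow 2 y).const_add (u ^ 2)
          convert h3.sqrt hpos.ne' using 1
          field_simp
        have h4 := ((hGd (Real.sqrt (u ^ 2 + y ^ 2))).scomp y h2).neg
        refine HasDerivAt.congr_deriv (f := fun y => - G (Real.sqrt (u ^ 2 + y ^ 2))) h4 ?_
        simp only [finrank_euclideanSpace, Fintype.card_fin, real_smul, mul_neg, neg_neg]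
        have hs' : ((Real.sqrt (u ^ 2 + y ^ 2) : ℝ) : ℂ) ≠ 0 := by exact_mod_cast hs.ne'
        push_cast
        field_simp
      have hc0 : ContinuousWithinAt (fun y => - G (Real.sqrt (u ^ 2 + y ^ 2))) (Set.Ici 0) 0 := by
        apply Continuous.continuousWithinAt
        fun_prop
      have hbig : ∀ y : ℝ, B ≤ y → B ≤ Real.sqrt (u ^ 2 + y ^ 2) := by
        intro y hy
        apply Real.le_sqrt_of_sq_le
        have : B ^ 2 ≤ y ^ 2 := by gcongr
        nlinarith [sq_nonneg u]
      have hi : IntegrableOn (fun y => y ^ (Module.finrank ℝ (EuclideanSpace ℝ (Fin 2)) - 1) •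
            g (Real.sqrt (u ^ 2 + y ^ 2))) (Set.Ioi 0) := by
        apply Integrable.integrableOn
        apply Continuous.integrable_of_hasCompactSupport
        · fun_prop
        · refine HasCompactSupport.intro (isCompact_closedBall (0 : ℝ) B) ?_
          intro y hy
          simp only [Metric.mem_closedBall, dist_zero_right, not_le, Real.norm_eq_abs] at hy
          have := hbig |y| hy.le
          rw [sq_abs] at this
          rw [hsupp _ this, smul_zero]
      have ht : Filter.Tendsto (fun y => - G (Real.sqrt (u ^ 2 + y ^ 2))) Filter.atTop (nhds 0) := by
        apply tendsto_const_nhds.congr'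
        filter_upwards [Filter.eventually_ge_atTop B] with y hy
        rw [hG0 _ (hbig y hy), neg_zero]
      rw [integral_Ioi_of_hasDerivAt_of_tendsto hc0 hd hi ht]
      simp only [ne_eq, OfNat.ofNat_ne_zero, not_false_eq_true, zero_pow, add_zero, Real.sqrt_sq_eq_abs,
        zero_sub, neg_neg, hGabs]
    rw [hI]
    simp only [finrank_euclideanSpace, Fintype.card_fin, real_smul, nsmul_eq_mul]
    push_cast
    ring
  rw [h1, Measure.volume_eq_prod, integral_prod f hfi]
  simp only [hf]
  simp_rw [integral_const_mul, hinner]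
  rw [intervalIntegral.integral_eq_integral_of_support_subset]
  · rw [← integral_const_mul]
    congr 1; ext u; ring
  · intro u hu
    rw [Function.mem_support] at hu
    by_contra hn
    apply hu
    suffices G u = 0 by simp only [hG] at this; rw [this, mul_zero]
    rw [← hGabs]
    apply hG0
    by_contra hlt
    push Not at hlt
    rw [abs_lt] at hlt
    exact hn ⟨hlt.1, hlt.2.le⟩
end radial

/-- one-dimensional Japanese bracket -/
def jr (w : ℝ) : ℝ := Real.sqrt (1 + w ^ 2)

lemma jr_pos (w : ℝ) : 0 < jr w := Real.sqrt_pos.2 (by positivity)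
lemma one_le_jr (w : ℝ) : 1 ≤ jr w := Real.one_le_sqrt.2 (by nlinarith [sq_nonneg w])
lemma abs_le_jr (w : ℝ) : |w| ≤ jr w := by
  unfold jr
  rw [← Real.sqrt_sq_eq_abs]
  exact Real.sqrt_le_sqrt (by linarith)
lemma jr_mono {a w : ℝ} (ha : 0 ≤ a) (h : a ≤ |w|) : jr a ≤ jr w := by
  unfold jr
  apply Real.sqrt_le_sqrt
  have : a ^ 2 ≤ |w| ^ 2 := by gcongr
  rw [sq_abs] at this
  linarith
lemma jr_cont : Continuous jr := by unfold jr; fun_prop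
lemma jr_deriv (w : ℝ) : HasDerivAt jr (w / jr w) w := by
  have h3 : HasDerivAt (fun y : ℝ => 1 + y ^ 2) (2 * w) w := by
    simpa using (hasDerivAt_pow 2 w).const_add (1 : ℝ)
  have hpos : (0 : ℝ) < 1 + w ^ 2 := by positivity
  refine (h3.sqrt hpos.ne').congr_deriv ?_
  unfold jr
  field_simp
lemma jr_rpow_cont (s : ℝ) : Continuous (fun w => jr w ^ s) :=
  jr_cont.rpow_const fun w => Or.inl (jr_pos w).ne'
lemma jr_rpow_deriv (s w : ℝ) :
    HasDerivAt (fun w => jr w ^ s) (w / jr w * s * jr w ^ (s - 1)) w :=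
  (jr_deriv w).rpow_const (Or.inl (jr_pos w).ne')
lemma jr_rpow_le {s a w : ℝ} (hs : s ≤ 0) (ha : 0 ≤ a) (h : a ≤ |w|) : jr w ^ s ≤ jr a ^ s :=
  Real.rpow_le_rpow_of_nonpos (jr_pos a) (jr_mono ha h) hs

/-- symmetrised cutoff -/
lemma cutoff_even (ρ : ℝ → ℝ) (hρ : ContDiff ℝ (⊤ : ℕ∞) ρ)
    (hρsupp : Function.support ρ ⊆ Set.Ioo (-2) 2) (hρ1 : ∀ s : ℝ, |s| ≤ 1 → ρ s = 1) :
    ∃ (η η' : ℝ → ℝ) (L : ℝ), 0 < L ∧ (∀ s, HasDerivAt η (η' s) s) ∧ Continuous η' ∧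
      (∀ s, |η s| ≤ L) ∧ (∀ s, |η' s| ≤ L) ∧ (∀ s, |s| ≤ 1 → η s = 1) ∧
      (∀ s, 2 ≤ |s| → η s = 0) ∧ (∀ s, |s| < 1 → η' s = 0) ∧
      (∀ s, η (-s) = η s) ∧ (∀ s, 0 ≤ s → η s = ρ s) := by
  set η : ℝ → ℝ := fun s => ρ |s| with hη
  have h1 : ∀ s, |s| ≤ 1 → η s = 1 := fun s hs => hρ1 _ (by simpa using hs)
  have h0 : ∀ s, 2 ≤ |s| → η s = 0 := by
    intro s hs
    by_contra h
    have := hρsupp (Function.mem_support.2 h)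
    linarith [this.2]
  have hsm : ContDiff ℝ 1 η := by
    rw [contDiff_iff_contDiffAt]
    intro s
    rcases lt_trichotomy s 0 with hs | hs | hs
    · have : ContDiff ℝ 1 (fun s : ℝ => ρ (-s)) := (hρ.of_le (by simp)).comp contDiff_neg
      refine this.contDiffAt.congr_of_eventuallyEq ?_
      filter_upwards [gt_mem_nhds hs] with y hy
      simp [hη, abs_of_neg hy]
    · refine (contDiffAt_const (c := (1 : ℝ))).congr_of_eventuallyEq ?_
      filter_upwards [Metric.ball_mem_nhds s one_pos] with y hy
      apply h1
      rw [hs] at hy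
      simpa using (Metric.mem_ball.1 hy).le
    · refine (hρ.of_le (by simp)).contDiffAt.congr_of_eventuallyEq ?_
      filter_upwards [lt_mem_nhds hs] with y hy
      simp [hη, abs_of_pos hy]
  have hcs : HasCompactSupport η := by
    refine HasCompactSupport.intro (isCompact_closedBall (0 : ℝ) 2) fun s hs => h0 s ?_
    simp only [Metric.mem_closedBall, dist_zero_right, not_le, Real.norm_eq_abs] at hs
    exact hs.le
  have hd : Differentiable ℝ η := hsm.differentiable (by simp)
  have hdc : Continuous (deriv η) := hsm.continuous_deriv (by simp)
  obtain ⟨L1, hL1⟩ := hcs.exists_bound_of_continuous hsm.continuous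
  obtain ⟨L2, hL2⟩ := hcs.deriv.exists_bound_of_continuous hdc
  refine ⟨η, deriv η, max (max L1 L2) 1, by positivity, fun s => (hd s).hasDerivAt, hdc,
    fun s => (hL1 s).trans ((le_max_left _ _).trans (le_max_left _ _)),
    fun s => (hL2 s).trans ((le_max_right _ _).trans (le_max_left _ _)), h1, h0, ?_, ?_, ?_⟩
  · intro s hs
    have : η =ᶠ[nhds s] fun _ => 1 := by
      filter_upwards [(continuous_abs.tendsto s).eventually (gt_mem_nhds hs)] with y hy
      exact h1 y hy.le
    rw [this.deriv_eq]
    simp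
  · intro s; simp [hη]
  · intro s hs; simp [hη, abs_of_nonneg hs]

lemma cut_facts {η η' : ℝ → ℝ} {L : ℝ} (_hL : 0 < L)
    (hd : ∀ s, HasDerivAt η (η' s) s) (hb : ∀ s, |η s| ≤ L) (hb' : ∀ s, |η' s| ≤ L)
    (h1 : ∀ s, |s| ≤ 1 → η s = 1) (h0' : ∀ s, |s| < 1 → η' s = 0) {l : ℝ} (hl : 0 < l) :
    (∀ w, HasDerivAt (fun w => η (w / (8 * l)) - η (w / l))
      (η' (w / (8 * l)) / (8 * l) - η' (w / l) / l) w) ∧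
    (∀ w, |η (w / (8 * l)) - η (w / l)| ≤ 2 * L) ∧
    (∀ w, |η' (w / (8 * l)) / (8 * l) - η' (w / l) / l| ≤ 2 * L / l) ∧
    (∀ w, |w| < l → η (w / (8 * l)) - η (w / l) = 0) ∧
    (∀ w, |w| < l → η' (w / (8 * l)) / (8 * l) - η' (w / l) / l = 0) := by
  have ha : ∀ w, |w / l| = |w| / l := fun w => by rw [abs_div, abs_of_pos hl]
  have ha8 : ∀ w, |w / (8 * l)| = |w| / (8 * l) := fun w => by
    rw [abs_div, abs_of_pos (by positivity : 0 < 8 * l)]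
  have hs1 : ∀ w, |w| < l → |w / l| < 1 := fun w hw => by
    rw [ha, div_lt_one hl]; exact hw
  have hs8 : ∀ w, |w| < l → |w / (8 * l)| < 1 := fun w hw => by
    rw [ha8, div_lt_one (by positivity)]; linarith
  refine ⟨?_, ?_, ?_, ?_, ?_⟩
  · intro w
    have e1 : HasDerivAt (fun w : ℝ => w / (8 * l)) (1 / (8 * l)) w := (hasDerivAt_id w).div_const _
    have e2 : HasDerivAt (fun w : ℝ => w / l) (1 / l) w := (hasDerivAt_id w).div_const _
    refine (((hd _).comp w e1).sub ((hd _).comp w e2)).congr_deriv ?_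
    ring
  · intro w
    have := abs_sub (η (w / (8 * l))) (η (w / l))
    linarith [hb (w / (8 * l)), hb (w / l)]
  · intro w
    have := abs_sub (η' (w / (8 * l)) / (8 * l)) (η' (w / l) / l)
    have e1 : |η' (w / (8 * l)) / (8 * l)| ≤ L / l := by
      rw [abs_div, abs_of_pos (by positivity : 0 < 8 * l)]
      exact div_le_div₀ _hL.le (hb' _) hl (by linarith)
    have e2 : |η' (w / l) / l| ≤ L / l := by
      rw [abs_div, abs_of_pos hl]
      exact div_le_div₀ _hL.le (hb' _) hl le_rfl
    calc _ ≤ L / l + L / l := by linarith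
      _ = _ := by ring
  · intro w hw
    rw [h1 _ (hs1 w hw).le, h1 _ (hs8 w hw).le, sub_self]
  · intro w hw
    rw [h0' _ (hs1 w hw), h0' _ (hs8 w hw)]; simp

lemma expI_norm (a : ℝ) : ‖Complex.exp (I * (a : ℂ))‖ = 1 := by
  rw [mul_comm]; exact Complex.norm_exp_ofReal_mul_I a

/-- One-dimensional oscillatory bounds. -/
lemma osc_bounds {η η' : ℝ → ℝ} {L γ : ℝ} (hL : 0 < L) (hγ : 1 < γ)
    (hd : ∀ s, HasDerivAt η (η' s) s) (hc' : Continuous η')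
    (hb : ∀ s, |η s| ≤ L) (hb' : ∀ s, |η' s| ≤ L)
    (h1 : ∀ s, |s| ≤ 1 → η s = 1) (h0' : ∀ s, |s| < 1 → η' s = 0) :
    ∃ C : ℝ, 0 < C ∧ ∀ (l t X : ℝ), 0 < l → ∀ J : ℂ,
      J = (∫ u in (-(16 * l))..(16 * l), Complex.exp (I * ((X * u : ℝ) : ℂ)) *
        ∫ w in u..(16 * l), (w : ℂ) * (Complex.exp (I * ((t * jr w : ℝ) : ℂ)) *
          ((jr w ^ (-γ) * (η (w / (8 * l)) - η (w / l)) : ℝ) : ℂ))) →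
      ‖J‖ ≤ C * (l ^ 3 * jr l ^ (-γ)) ∧ (0 < X → ‖J‖ ≤ C / X * (l * jr l ^ (1 - γ))) ∧
      (t ≠ 0 → ‖J‖ ≤ C / |t| * (l * jr l ^ (1 - γ))) := by
  refine ⟨100000 * L * (1 + γ), by positivity, ?_⟩
  intro l t X hl J hJ
  obtain ⟨hχd, hχb, hχb', hχ0, hχ0'⟩ := cut_facts hL hd hb hb' h1 h0' hl
  set χ : ℝ → ℝ := fun w => η (w / (8 * l)) - η (w / l) with hχ
  set χ' : ℝ → ℝ := fun w => η' (w / (8 * l)) / (8 * l) - η' (w / l) / l with hχ'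
  have hχc : Continuous χ := continuous_iff_continuousAt.2 fun w => (hχd w).continuousAt
  have hχc' : Continuous χ' := by simp only [hχ']; fun_prop
  set B := 16 * l with hB
  have hBpos : 0 < B := by positivity
  set g : ℝ → ℂ := fun w => Complex.exp (I * ((t * jr w : ℝ) : ℂ)) * ((jr w ^ (-γ) * χ w : ℝ) : ℂ)
    with hg
  have hjc := jr_cont
  have hgc : Continuous g := by
    have := jr_rpow_cont (-γ)
    simp only [hg]
    fun_prop
  have hwg : Continuous (fun w : ℝ => (w : ℂ) * g w) := by fun_prop
  set G : ℝ → ℂ := fun u => ∫ w in u..B, (w : ℂ) * g w with hG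
  have hGd : ∀ u : ℝ, HasDerivAt G (-((u : ℂ) * g u)) u := fun u =>
    intervalIntegral.integral_hasDerivAt_left (hwg.intervalIntegrable _ _)
      (hwg.stronglyMeasurableAtFilter _ _) hwg.continuousAt
  have hGc : Continuous G := continuous_iff_continuousAt.2 fun u => (hGd u).continuousAt
  replace hJ : J = ∫ u in (-B)..B, Complex.exp (I * ((X * u : ℝ) : ℂ)) * G u := hJ
  set m := jr l ^ (-γ) with hm
  have hmpos : 0 < m := Real.rpow_pos_of_pos (jr_pos l) _
  set m1 := jr l ^ (1 - γ) with hm1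
  have hm1pos : 0 < m1 := Real.rpow_pos_of_pos (jr_pos l) _
  have hlm : l * m ≤ m1 := by
    have : m1 = jr l * m := by
      rw [hm1, hm, sub_eq_add_neg, Real.rpow_add (jr_pos l), Real.rpow_one]
    rw [this]
    gcongr
    exact (le_abs_self l).trans (abs_le_jr l)
  have hwgb : ∀ w : ℝ, |w| ≤ B → ‖(w : ℂ) * g w‖ ≤ 32 * L * l * m := by
    intro w hw
    rw [norm_mul, hg]
    simp only
    rw [norm_mul, expI_norm, one_mul, Complex.norm_real, Complex.norm_real, Real.norm_eq_abs,
      Real.norm_eq_abs, abs_mul, abs_of_pos (Real.rpow_pos_of_pos (jr_pos w) _)]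
    by_cases hwl : |w| < l
    · have : χ w = 0 := hχ0 w hwl
      rw [this]; simp; positivity
    · push Not at hwl
      have e1 : jr w ^ (-γ) ≤ m := jr_rpow_le (by linarith) hl.le hwl
      have hp : 0 < jr w ^ (-γ) := Real.rpow_pos_of_pos (jr_pos w) _
      calc |w| * (jr w ^ (-γ) * |χ w|) ≤ B * (m * (2 * L)) := by
            gcongr
            exact hχb w
        _ = _ := by rw [hB]; ring
  have hGb : ∀ u : ℝ, |u| ≤ B → ‖G u‖ ≤ 1024 * L * l ^ 2 * m := by
    intro u hu
    have hu' := abs_le.1 hu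
    have := intervalIntegral.norm_integral_le_of_norm_le_const (a := u) (b := B)
      (C := 32 * L * l * m) (f := fun w : ℝ => (w : ℂ) * g w) (by
        intro w hw
        rw [Set.uIoc_of_le hu'.2] at hw
        exact hwgb w (abs_le.2 ⟨by linarith [hw.1], hw.2⟩))
    refine this.trans ?_
    rw [abs_of_nonneg (by linarith)]
    calc 32 * L * l * m * (B - u) ≤ 32 * L * l * m * (32 * l) := by
          gcongr
          linarith
      _ = _ := by ring
  have hJb : ∀ D : ℝ, (∀ u : ℝ, |u| ≤ B → ‖G u‖ ≤ D) → ‖J‖ ≤ D * (32 * l) := by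
    intro D hD
    rw [hJ]
    have := intervalIntegral.norm_integral_le_of_norm_le_const (a := -B) (b := B)
      (C := D) (f := fun u : ℝ => Complex.exp (I * ((X * u : ℝ) : ℂ)) * G u) (by
        intro w hw
        rw [Set.uIoc_of_le (by linarith)] at hw
        rw [norm_mul, expI_norm, one_mul]
        exact hD w (abs_le.2 ⟨by linarith [hw.1], hw.2⟩))
    refine this.trans (le_of_eq ?_)
    rw [abs_of_nonneg (by linarith), hB]
    ring
  refine ⟨?_, ?_, ?_⟩
  · refine (hJb _ hGb).trans ?_
    have : 0 < L * l ^ 3 * m := by positivity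
    nlinarith
  · intro hX
    have hXc : (I * (X : ℂ)) ≠ 0 := by simp [hX.ne']
    set v : ℝ → ℂ := fun u => Complex.exp (I * ((X * u : ℝ) : ℂ)) / (I * X) with hv
    have hvd : ∀ u : ℝ, HasDerivAt v (Complex.exp (I * ((X * u : ℝ) : ℂ))) u := by
      intro u
      have e1 : HasDerivAt (fun u : ℝ => I * ((X * u : ℝ) : ℂ)) (I * X) u := by
        have := ((hasDerivAt_id u).const_mul X).ofReal_comp.const_mul I
        simpa using this
      refine (e1.cexp.div_const (I * X)).congr_deriv ?_
      have hX' : (X : ℂ) ≠ 0 := by exact_mod_cast hX.ne'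
      field_simp
    have hvn : ∀ u, ‖v u‖ = 1 / X := by
      intro u
      simp only [hv]
      rw [norm_div, expI_norm, norm_mul, Complex.norm_I, one_mul, Complex.norm_real,
        Real.norm_of_nonneg hX.le]
    have hexpc : Continuous (fun u : ℝ => Complex.exp (I * ((X * u : ℝ) : ℂ))) := by fun_prop
    have hibp := intervalIntegral.integral_mul_deriv_eq_deriv_mul (a := -B) (b := B)
      (fun u _ => hGd u) (fun u _ => hvd u) (hwg.neg.intervalIntegrable _ _)
      (hexpc.intervalIntegrable _ _)
    have hJ2 : J = G B * v B - G (-B) * v (-B) - ∫ u in (-B)..B, -((u : ℂ) * g u) * v u := by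
      rw [hJ, ← hibp]
      congr 1; ext u; ring
    have hI : ‖∫ u in (-B)..B, -((u : ℂ) * g u) * v u‖ ≤ 32 * L * l * m * (1 / X) * (32 * l) := by
      have := intervalIntegral.norm_integral_le_of_norm_le_const (a := -B) (b := B)
        (C := 32 * L * l * m * (1 / X)) (f := fun u : ℝ => -((u : ℂ) * g u) * v u) (by
          intro w hw
          rw [Set.uIoc_of_le (by linarith)] at hw
          rw [norm_mul, norm_neg, hvn]
          gcongr
          exact hwgb w (abs_le.2 ⟨by linarith [hw.1], hw.2⟩))
      refine this.trans (le_of_eq ?_)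
      rw [abs_of_nonneg (by linarith), hB]
      ring
    have hG1 : ‖G B * v B‖ ≤ 1024 * L * l ^ 2 * m * (1 / X) := by
      rw [norm_mul, hvn]
      gcongr
      exact hGb B (abs_of_pos hBpos).le
    have hG2 : ‖G (-B) * v (-B)‖ ≤ 1024 * L * l ^ 2 * m * (1 / X) := by
      rw [norm_mul, hvn]
      gcongr
      exact hGb (-B) (by rw [abs_neg, abs_of_pos hBpos])
    have hfin : ‖J‖ ≤ 3072 * L * (1 / X) * l * (l * m) := by
      rw [hJ2]
      have := norm_sub_le (G B * v B - G (-B) * v (-B)) (∫ u in (-B)..B, -((u : ℂ) * g u) * v u)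
      have := norm_sub_le (G B * v B) (G (-B) * v (-B))
      nlinarith
    refine hfin.trans ?_
    calc 3072 * L * (1 / X) * l * (l * m) ≤ 3072 * L * (1 / X) * l * m1 := by gcongr
      _ = 3072 * L * (l * m1 / X) := by ring
      _ ≤ 100000 * L * (1 + γ) * (l * m1 / X) := by
          have : 0 < L * (l * m1 / X) := by positivity
          nlinarith
      _ = _ := by ring
  · intro ht
    have htpos : 0 < |t| := abs_pos.2 ht
    set A : ℝ → ℂ := fun w => ((jr w ^ (1 - γ) * χ w : ℝ) : ℂ) with hA
    set A' : ℝ → ℝ := fun w => w / jr w * (1 - γ) * jr w ^ (1 - γ - 1) * χ w +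
      jr w ^ (1 - γ) * χ' w with hA'
    have hAd : ∀ w : ℝ, HasDerivAt A ((A' w : ℝ) : ℂ) w := fun w =>
      ((jr_rpow_deriv (1 - γ) w).mul (hχd w)).ofReal_comp
    have hAb : ∀ w : ℝ, ‖A w‖ ≤ 2 * L * m1 := by
      intro w
      simp only [hA]
      rw [Complex.norm_real, Real.norm_eq_abs, abs_mul,
        abs_of_pos (Real.rpow_pos_of_pos (jr_pos w) _)]
      by_cases hwl : |w| < l
      · have : χ w = 0 := hχ0 w hwl
        rw [this]; simp; positivity
      · push Not at hwl
        have e1 : jr w ^ (1 - γ) ≤ m1 := jr_rpow_le (by linarith) hl.le hwl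
        calc jr w ^ (1 - γ) * |χ w| ≤ m1 * (2 * L) := by
              gcongr
              exact hχb w
          _ = _ := by ring
    have hAb' : ∀ w : ℝ, |A' w| ≤ 2 * L * γ * m1 / l := by
      intro w
      by_cases hwl : |w| < l
      · have e1 : χ w = 0 := hχ0 w hwl
        have e2 : χ' w = 0 := hχ0' w hwl
        simp only [hA', e1, e2]; simp; positivity
      · push Not at hwl
        have e1 : jr w ^ (1 - γ) ≤ m1 := jr_rpow_le (by linarith) hl.le hwl
        have e2 : jr w ^ (1 - γ - 1) ≤ m1 / l := by
          rw [Real.rpow_sub_one (jr_pos w).ne']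
          exact div_le_div₀ hm1pos.le e1 hl (hwl.trans (abs_le_jr w))
        have e3 : |w / jr w| ≤ 1 := by
          rw [abs_div, abs_of_pos (jr_pos w), div_le_one (jr_pos w)]
          exact abs_le_jr w
        have hp1 : 0 < jr w ^ (1 - γ - 1) := Real.rpow_pos_of_pos (jr_pos w) _
        have hp2 : 0 < jr w ^ (1 - γ) := Real.rpow_pos_of_pos (jr_pos w) _
        calc |A' w| ≤ |w / jr w * (1 - γ) * jr w ^ (1 - γ - 1) * χ w| + |jr w ^ (1 - γ) * χ' w| :=
              abs_add_le _ _
          _ = |w / jr w| * (γ - 1) * jr w ^ (1 - γ - 1) * |χ w| + jr w ^ (1 - γ) * |χ' w| := by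
              rw [abs_mul, abs_mul, abs_mul, abs_mul, abs_of_pos hp1, abs_of_pos hp2,
                abs_of_neg (by linarith : 1 - γ < 0), neg_sub]
          _ ≤ 1 * (γ - 1) * (m1 / l) * (2 * L) + m1 * (2 * L / l) := by
              have : 0 ≤ γ - 1 := by linarith
              gcongr
              · exact hχb w
              · exact hχb' w
          _ = _ := by ring
    set v : ℝ → ℂ := fun w => Complex.exp (I * ((t * jr w : ℝ) : ℂ)) / (I * t) with hv
    have htc : (I * (t : ℂ)) ≠ 0 := by simp [ht]
    have hvd : ∀ w : ℝ, HasDerivAt v (Complex.exp (I * ((t * jr w : ℝ) : ℂ)) *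
        ((w / jr w : ℝ) : ℂ)) w := by
      intro u
      have e1 : HasDerivAt (fun w : ℝ => I * ((t * jr w : ℝ) : ℂ))
          (I * ((t * (u / jr u) : ℝ) : ℂ)) u :=
        ((jr_deriv u).const_mul t).ofReal_comp.const_mul I
      refine (e1.cexp.div_const (I * t)).congr_deriv ?_
      have ht' : (t : ℂ) ≠ 0 := by exact_mod_cast ht
      have e6 : (jr u : ℂ) ≠ 0 := by exact_mod_cast (jr_pos u).ne'
      push_cast
      field_simp
    have hvn : ∀ u, ‖v u‖ = 1 / |t| := by
      intro u
      simp only [hv]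
      rw [norm_div, expI_norm, norm_mul, Complex.norm_I, one_mul, Complex.norm_real,
        Real.norm_eq_abs]
    have hA'c : Continuous (fun w => ((A' w : ℝ) : ℂ)) := by
      have e1 := jr_rpow_cont (1 - γ)
      have e2 := jr_rpow_cont (1 - γ - 1)
      have e3 : Continuous (fun w => w / jr w) := continuous_id.div jr_cont fun w => (jr_pos w).ne'
      simp only [hA']
      fun_prop
    have hv'c : Continuous (fun w : ℝ => Complex.exp (I * ((t * jr w : ℝ) : ℂ)) *
        ((w / jr w : ℝ) : ℂ)) := by
      have e3 : Continuous (fun w => w / jr w) := continuous_id.div jr_cont fun w => (jr_pos w).ne'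
      fun_prop
    have hGt : ∀ u : ℝ, |u| ≤ B → ‖G u‖ ≤ (4 + 64 * γ) * L * m1 / |t| := by
      intro u hu
      have hu' := abs_le.1 hu
      have hibp := intervalIntegral.integral_mul_deriv_eq_deriv_mul (a := u) (b := B)
        (fun u _ => hAd u) (fun u _ => hvd u) (hA'c.intervalIntegrable _ _)
        (hv'c.intervalIntegrable _ _)
      have hG2 : G u = A B * v B - A u * v u - ∫ w in u..B, ((A' w : ℝ) : ℂ) * v w := by
        rw [← hibp]
        simp only [hG]
        congr 1; ext w
        have e5 : jr w ^ (1 - γ) = jr w * jr w ^ (-γ) := by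
          rw [sub_eq_add_neg, Real.rpow_add (jr_pos w), Real.rpow_one]
        have e6 : (jr w : ℂ) ≠ 0 := by exact_mod_cast (jr_pos w).ne'
        simp only [hg, hA, e5]
        push_cast
        field_simp
      have hI : ‖∫ w in u..B, ((A' w : ℝ) : ℂ) * v w‖ ≤
          2 * L * γ * m1 / l * (1 / |t|) * (32 * l) := by
        have := intervalIntegral.norm_integral_le_of_norm_le_const (a := u) (b := B)
          (C := 2 * L * γ * m1 / l * (1 / |t|)) (f := fun w : ℝ => ((A' w : ℝ) : ℂ) * v w) (by
            intro w hw
            rw [norm_mul, hvn, Complex.norm_real, Real.norm_eq_abs]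
            gcongr
            exact hAb' w)
        refine this.trans ?_
        rw [abs_of_nonneg (by linarith : (0:ℝ) ≤ B - u)]
        gcongr
        linarith
      have hI' : 2 * L * γ * m1 / l * (1 / |t|) * (32 * l) = 64 * γ * (L * m1 / |t|) := by
        field_simp; ring
      have hA1 : ∀ w, ‖A w * v w‖ ≤ 2 * (L * m1 / |t|) := by
        intro w
        rw [norm_mul, hvn]
        calc ‖A w‖ * (1 / |t|) ≤ 2 * L * m1 * (1 / |t|) := by gcongr; exact hAb w
          _ = _ := by ring
      rw [hG2]
      have s1 := norm_sub_le (A B * v B - A u * v u) (∫ w in u..B, ((A' w : ℝ) : ℂ) * v w)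
      have s2 := norm_sub_le (A B * v B) (A u * v u)
      have s3 := hA1 B
      have s4 := hA1 u
      rw [hI'] at hI
      calc _ ≤ 4 * (L * m1 / |t|) + 64 * γ * (L * m1 / |t|) := by linarith
        _ = _ := by ring
    refine (hJb _ hGt).trans ?_
    have : 0 < L * m1 / |t| * l := by positivity
    calc (4 + 64 * γ) * L * m1 / |t| * (32 * l) = 32 * (4 + 64 * γ) * (L * m1 / |t| * l) := by ring
      _ ≤ 100000 * (1 + γ) * (L * m1 / |t| * l) := by
          refine mul_le_mul_of_nonneg_right ?_ this.le
          nlinarith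
      _ = _ := by ring

/-- bounds for the localized kernel -/
lemma Kloc_bound (γ : ℝ) (hγ : 1 < γ) (ρ : ℝ → ℝ) (hρ : ContDiff ℝ (⊤ : ℕ∞) ρ)
    (hρsupp : Function.support ρ ⊆ Set.Ioo (-2) 2) (hρ1 : ∀ s : ℝ, |s| ≤ 1 → ρ s = 1) :
    ∃ C : ℝ, 0 < C ∧ ∀ (k : ℤ) (x : EuclideanSpace ℝ (Fin 3)) (t l : ℝ), l = (2 : ℝ) ^ (k - 2) →
      ‖Kloc ρ γ k x t‖ ≤ C * (l ^ 3 * jr l ^ (-γ)) ∧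
      (0 < max ‖x‖ |t| → ‖Kloc ρ γ k x t‖ ≤ C / max ‖x‖ |t| * (l * jr l ^ (1 - γ))) := by
  obtain ⟨η, η', L, hL, hd, hc', hb, hb', h1, h0, h0', hev, hηρ⟩ := cutoff_even ρ hρ hρsupp hρ1
  obtain ⟨C, hC, hosc⟩ := osc_bounds hL hγ hd hc' hb hb' h1 h0'
  obtain ⟨c, hFT⟩ := radial_FT
  have hc1 : |c| ≤ |c| + 1 := by linarith
  have hc0 : 0 < |c| + 1 := by positivity
  refine ⟨(|c| + 1) * C, by positivity, ?_⟩
  intro k x t l hl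
  have hlpos : 0 < l := by rw [hl]; positivity
  have hηc : Continuous η := continuous_iff_continuousAt.2 fun w => (hd w).continuousAt
  set g : ℝ → ℂ := fun w => Complex.exp (I * ((t * jr w : ℝ) : ℂ)) *
    ((jr w ^ (-γ) * (η (w / (8 * l)) - η (w / l)) : ℝ) : ℂ) with hg
  have hgc : Continuous g := by
    have e1 := jr_cont
    have e2 := jr_rpow_cont (-γ)
    simp only [hg]
    fun_prop
  have hje : ∀ w, jr (-w) = jr w := fun w => by unfold jr; rw [neg_sq]
  have hge : ∀ w, g (-w) = g w := fun w => by
    simp only [hg, hje, neg_div, hev]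
  have hgs : ∀ w, 16 * l ≤ w → g w = 0 := fun w hw => by
    have e1 : η (w / (8 * l)) = 0 := by
      apply h0
      rw [abs_of_nonneg (by apply div_nonneg <;> nlinarith), le_div_iff₀ (by positivity)]
      linarith
    have e2 : η (w / l) = 0 := by
      apply h0
      rw [abs_of_nonneg (by apply div_nonneg <;> nlinarith), le_div_iff₀ (by positivity)]
      linarith
    simp [hg, e1, e2]
  have hK : Kloc ρ γ k x t = ∫ ξ : EuclideanSpace ℝ (Fin 3),
      Complex.exp (I * (dotE x ξ : ℝ)) * g ‖ξ‖ := by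
    unfold Kloc
    congr 1
    ext ξ
    have e1 : chiLP ρ k ξ = η (‖ξ‖ / (8 * l)) - η (‖ξ‖ / l) := by
      unfold chiLP
      rw [hηρ _ (by positivity), hηρ _ (by positivity), hl]
      congr 2
      · rw [zpow_neg, div_eq_inv_mul]
        congr 2
        rw [show k + 1 = (k - 2) + 3 by ring, zpow_add₀ (by norm_num)]
        norm_num; ring
      · rw [zpow_neg, div_eq_inv_mul]
    have e2 : jap ξ = jr ‖ξ‖ := rfl
    rw [e1, e2]
    simp only [hg]
    rw [← mul_assoc, ← Complex.exp_add]
    congr 2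
    push_cast; ring
  rw [hFT x g (16 * l) (by positivity) hgc hge hgs] at hK
  obtain ⟨b1, b2, b3⟩ := hosc l t ‖x‖ hlpos _ rfl
  set J := ∫ u in (-(16 * l))..(16 * l), Complex.exp (I * ((‖x‖ * u : ℝ) : ℂ)) *
        ∫ w in u..(16 * l), (w : ℂ) * g w with hJ
  have hKn : ‖Kloc ρ γ k x t‖ ≤ (|c| + 1) * ‖J‖ := by
    rw [hK, norm_mul, Complex.norm_real, Real.norm_eq_abs]
    gcongr
  constructor
  · refine hKn.trans ?_
    rw [mul_assoc]
    gcongr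
  · intro hM
    refine hKn.trans ?_
    rw [mul_div_assoc, mul_assoc]
    gcongr
    rcases max_choice ‖x‖ |t| with h | h
    · rw [h] at hM ⊢
      exact b2 hM
    · rw [h] at hM ⊢
      exact b3 (abs_pos.1 hM)

lemma Kker_bound (γ : ℝ) (hγ : 1 < γ) (ρ : ℝ → ℝ) (hρ : ContDiff ℝ (⊤ : ℕ∞) ρ)
    (hρsupp : Function.support ρ ⊆ Set.Ioo (-2) 2) (hρ1 : ∀ s : ℝ, |s| ≤ 1 → ρ s = 1)
    {a : ℝ} (ha0 : 0 ≤ a) (ha1 : a ≤ 1) (haγ : 3 - γ < a) :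
    ∃ C : ℝ, 0 < C ∧ ∀ (x : EuclideanSpace ℝ (Fin 3)) (t : ℝ), 0 < max ‖x‖ |t| →
      ‖Kker ρ γ x t‖ ≤ C * max ‖x‖ |t| ^ (-a) := by
  obtain ⟨C, hC, hb⟩ := Kloc_bound γ hγ ρ hρ hρsupp hρ1
  set e := min (3 - 2 * a) (γ + a - 3) with he
  have hepos : 0 < e := lt_min (by linarith) (by linarith)
  have he1 : e ≤ 3 - 2 * a := min_le_left _ _
  have he2 : e ≤ γ + a - 3 := min_le_right _ _
  set b : ℤ → ℝ := fun k => 2 ^ (2 * e) * ((2 : ℝ) ^ (-e)) ^ k.natAbs with hbdef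
  have hr1 : (2 : ℝ) ^ (-e) < 1 := Real.rpow_lt_one_of_one_lt_of_neg (by norm_num) (by linarith)
  have hr0 : 0 ≤ (2 : ℝ) ^ (-e) := by positivity
  have hgeo := summable_geometric_of_lt_one hr0 hr1
  have hsum : Summable b := by
    refine Summable.mul_left _ (Summable.of_nat_of_neg ?_ ?_)
    · simpa using hgeo
    · simpa using hgeo
  have hbpos : ∀ k, 0 < b k := fun k => by simp only [hbdef]; positivity
  have hspos : 0 < ∑' k, b k := hsum.tsum_pos (fun k => (hbpos k).le) 0 (hbpos 0)
  refine ⟨C * ∑' k, b k, by positivity, ?_⟩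
  intro x t hM
  set M := max ‖x‖ |t| with hMdef
  have key : ∀ k : ℤ, ‖Kloc ρ γ k x t‖ ≤ C * M ^ (-a) * b k := by
    intro k
    obtain ⟨u1, u2⟩ := hb k x t _ rfl
    replace u2 := u2 hM
    set l : ℝ := (2 : ℝ) ^ (k - 2) with hl
    have hl' : l = (2 : ℝ) ^ ((k : ℝ) - 2) := by
      rw [hl, ← Real.rpow_intCast]; push_cast; rfl
    have hlpos : 0 < l := by rw [hl]; positivity
    have hj := jr_pos l
    set y := ‖Kloc ρ γ k x t‖ with hy
    have hy0 : 0 ≤ y := norm_nonneg _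
    have s1 : y ≤ C * M ^ (-a) * (l ^ (3 - 2 * a) * jr l ^ (a - γ)) := by
      rcases hy0.eq_or_lt with h | h
      · rw [← h]; positivity
      have p1 : y ^ (1 - a) ≤ (C * (l ^ 3 * jr l ^ (-γ))) ^ (1 - a) :=
        Real.rpow_le_rpow hy0 u1 (by linarith)
      have p2 : y ^ a ≤ (C / M * (l * jr l ^ (1 - γ))) ^ a := Real.rpow_le_rpow hy0 u2 ha0
      have p3 : y = y ^ (1 - a) * y ^ a := by
        rw [← Real.rpow_add h]; simp
      rw [p3]
      refine (mul_le_mul p1 p2 (by positivity) (by positivity)).trans (le_of_eq ?_)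
      rw [Real.mul_rpow (by positivity) (by positivity), Real.mul_rpow (by positivity) (by positivity),
        Real.mul_rpow (by positivity) (by positivity), Real.mul_rpow (by positivity) (by positivity),
        Real.div_rpow (by positivity) (by positivity), ← Real.rpow_natCast l 3,
        ← Real.rpow_mul hj.le, ← Real.rpow_mul hj.le, ← Real.rpow_mul hlpos.le,
        Real.rpow_neg hM.le]
      have q1 : C = C ^ (1 - a) * C ^ a := by rw [← Real.rpow_add hC]; simp
      have q2 : l ^ (3 - 2 * a) = l ^ (((3 : ℕ) : ℝ) * (1 - a)) * l ^ a := by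
        rw [← Real.rpow_add hlpos]; congr 1; push_cast; ring
      have q3 : jr l ^ (a - γ) = jr l ^ (-γ * (1 - a)) * jr l ^ ((1 - γ) * a) := by
        rw [← Real.rpow_add hj]; congr 1; ring
      rw [q2, q3]
      nth_rw 3 [q1]
      ring
    refine s1.trans ?_
    gcongr
    simp only [hbdef]
    have hbk : ((2 : ℝ) ^ (-e)) ^ k.natAbs = 2 ^ (-e * |(k : ℝ)|) := by
      rw [← Real.rpow_natCast, ← Real.rpow_mul (by norm_num), Nat.cast_natAbs, Int.cast_abs]
    rw [hbk, ← Real.rpow_add (by norm_num)]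
    by_cases hk : (k : ℝ) ≤ 2
    · have v1 : jr l ^ (a - γ) ≤ 1 := Real.rpow_le_one_of_one_le_of_nonpos (one_le_jr l) (by linarith)
      calc l ^ (3 - 2 * a) * jr l ^ (a - γ) ≤ l ^ (3 - 2 * a) * 1 := by gcongr
        _ = 2 ^ (((k : ℝ) - 2) * (3 - 2 * a)) := by
            rw [mul_one, hl', ← Real.rpow_mul (by norm_num)]
        _ ≤ _ := by
            apply Real.rpow_le_rpow_of_exponent_le (by norm_num)
            rcases abs_cases (k : ℝ) with h | h <;> nlinarith
    · push Not at hk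
      have v1 : jr l ^ (a - γ) ≤ l ^ (a - γ) :=
        Real.rpow_le_rpow_of_nonpos hlpos ((le_abs_self l).trans (abs_le_jr l)) (by linarith)
      calc l ^ (3 - 2 * a) * jr l ^ (a - γ) ≤ l ^ (3 - 2 * a) * l ^ (a - γ) := by gcongr
        _ = 2 ^ (((k : ℝ) - 2) * (3 - a - γ)) := by
            rw [← Real.rpow_add hlpos, hl', ← Real.rpow_mul (by norm_num)]
            congr 1; ring
        _ ≤ _ := by
            apply Real.rpow_le_rpow_of_exponent_le (by norm_num)
            rw [abs_of_nonneg (by linarith)]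
            nlinarith
  have hs : HasSum (fun k => C * M ^ (-a) * b k) (C * M ^ (-a) * ∑' k, b k) :=
    hsum.hasSum.mul_left _
  have := tsum_of_norm_bounded hs key
  unfold Kker
  refine this.trans (le_of_eq ?_)
  ring

lemma exps {σ Q R : ℝ} (hσ : 1 < σ) (hR : 6 < R) (h : Q + 3 / R > 3 / 2 - σ) :
    ∃ a b : ℝ, 0 ≤ a ∧ 0 ≤ b ∧ a < 6 / R ∧ (b = 0 ∨ b < 2 * Q) ∧ a + b ≤ 1 ∧ 3 - 2 * σ < a + b := by
  have e1 : 6 / R = 2 * (3 / R) := by ring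
  set P := 6 / R with hP
  have hP0 : 0 < P := by rw [hP]; positivity
  have hP1 : P < 1 := by rw [hP, div_lt_one (by linarith)]; exact hR
  by_cases hc : 3 - 2 * σ < P
  · refine ⟨max 0 ((3 - 2 * σ + P) / 2), 0, le_max_left _ _, le_rfl, ?_, Or.inl rfl, ?_, ?_⟩
    · exact max_lt hP0 (by linarith)
    · rw [add_zero]; exact max_le (by norm_num) (by linarith)
    · rw [add_zero]; exact lt_max_of_lt_right (by linarith)
  · push Not at hc
    obtain ⟨s, hs1, hs2⟩ : ∃ s, 3 - 2 * σ < s ∧ s < min 1 (2 * Q + P) :=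
      exists_between (lt_min (by linarith) (by linarith))
    obtain ⟨hs2, hs3⟩ := lt_min_iff.1 hs2
    obtain ⟨d, hd1, hd2⟩ : ∃ d, 0 < d ∧ d < min P (2 * Q + P - s) :=
      exists_between (lt_min (by linarith) (by linarith))
    obtain ⟨hd2, hd3⟩ := lt_min_iff.1 hd2
    exact ⟨P - d, s - P + d, by linarith, by linarith, by linarith, Or.inr (by linarith),
      by linarith, by linarith⟩

/-- truncated singularity -/
def sing {E : Type*} [NormedAddCommGroup E] (a : ℝ) (x : E) : ℝ≥0∞ :=
  (Metric.ball (0 : E) 2).indicator (fun x => ‖x‖ₑ ^ (-a)) x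

lemma sing_meas {E : Type*} [NormedAddCommGroup E] [MeasurableSpace E] [BorelSpace E] (a : ℝ) :
    Measurable (sing a : E → ℝ≥0∞) := by
  have hm : Measurable (fun x : E => ‖x‖ₑ ^ (-a)) := by fun_prop
  exact hm.indicator measurableSet_ball

lemma sing_out {E : Type*} [NormedAddCommGroup E] (a : ℝ) (x : E)
    (h : x ∉ Metric.ball (0 : E) 2) : sing a x = 0 := by
  unfold sing; exact Set.indicator_of_notMem h _

lemma sing_zero_le {E : Type*} [NormedAddCommGroup E] (x : E) : sing 0 x ≤ 1 := by
  classical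
  unfold sing; simp only [Set.indicator_apply]
  split_ifs <;> simp

lemma sing_ne_top {E : Type*} [NormedAddCommGroup E] (a : ℝ) (x : E) (hx : x ≠ 0) :
    sing a x ≠ ∞ := by
  classical
  unfold sing; simp only [Set.indicator_apply]
  split_ifs
  · exact ENNReal.rpow_ne_top_of_ne_zero (by simpa using hx) (by simp)
  · simp

lemma sing_NP {E : Type*} [NormedAddCommGroup E] [NormedSpace ℝ E] [MeasurableSpace E]
    [BorelSpace E] [FiniteDimensional ℝ E] (μ : Measure E) [μ.IsAddHaarMeasure]
    (hd : 1 ≤ Module.finrank ℝ E) {a p : ℝ} (ha : 0 ≤ a) (hp : 0 < p)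
    (h : a * p < Module.finrank ℝ E) : NP μ p (sing a : E → ℝ≥0∞) ≠ ∞ := by
  classical
  unfold NP
  refine ENNReal.rpow_ne_top_of_nonneg (by positivity) ?_
  refine ne_of_eq_of_ne ?_ (lint_ball_rpow μ hd (R := 2) (s := a * p) (by positivity) h).ne
  congr 1; ext x
  unfold sing; simp only [Set.indicator_apply]
  split_ifs
  · rw [← ENNReal.rpow_mul]; congr 1; ring
  · simp [hp]

lemma majorant {σ : ℝ} (hσ : 1 < σ) (ρ : ℝ → ℝ) (hρ : ContDiff ℝ (⊤ : ℕ∞) ρ)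
    (hρsupp : Function.support ρ ⊆ Set.Ioo (-2) 2) (hρ1 : ∀ s : ℝ, |s| ≤ 1 → ρ s = 1)
    {a b : ℝ} (ha : 0 ≤ a) (hb : 0 ≤ b) (hab : a + b ≤ 1) (hs : 3 - 2 * σ < a + b) :
    ∃ C : ℝ≥0∞, C ≠ ∞ ∧ ∀ (x : EuclideanSpace ℝ (Fin 3)) (t : ℝ),
      ‖Kker ρ (2 * σ) x t‖ₑ ≤
        C * (ENNReal.ofReal (1 + |t| + ‖x‖) ^ (-1 : ℝ) + sing a x * sing b t) := by
  obtain ⟨C1, hC1, h1⟩ := Kker_bound (2 * σ) (by linarith) ρ hρ hρsupp hρ1 (a := 1)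
    (by norm_num) le_rfl (by linarith)
  obtain ⟨C2, hC2, h2⟩ := Kker_bound (2 * σ) (by linarith) ρ hρ hρsupp hρ1 (a := a + b)
    (by linarith) hab hs
  set C3 := ‖Kker ρ (2 * σ) 0 0‖ₑ with hC3
  refine ⟨ENNReal.ofReal (3 * C1) + ENNReal.ofReal C2 + C3,
    ENNReal.add_ne_top.2 ⟨ENNReal.add_ne_top.2 ⟨ENNReal.ofReal_ne_top, ENNReal.ofReal_ne_top⟩,
      enorm_ne_top⟩, ?_⟩
  intro x t
  rcases (le_max_of_le_left (norm_nonneg x) : 0 ≤ max ‖x‖ |t|).eq_or_lt with h | h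
  · have hx : x = 0 := norm_le_zero_iff.1 (by rw [h]; exact le_max_left _ _)
    have ht : t = 0 := abs_eq_zero.1 (le_antisymm (by rw [h]; exact le_max_right _ _) (abs_nonneg _))
    subst hx; subst ht
    calc C3 ≤ (ENNReal.ofReal (3 * C1) + ENNReal.ofReal C2 + C3) * 1 := by
          rw [mul_one]; exact le_add_self
      _ ≤ _ := by
          gcongr
          simp
  · set M := max ‖x‖ |t| with hM
    by_cases hM1 : 1 < M
    · have k1 := h1 x t h
      rw [← ofReal_norm]
      have k2 : ‖Kker ρ (2 * σ) x t‖ ≤ (3 * C1) * (1 + |t| + ‖x‖) ^ (-1 : ℝ) := by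
        refine k1.trans ?_
        rw [Real.rpow_neg_one, Real.rpow_neg_one]
        have : 1 + |t| + ‖x‖ ≤ 3 * M := by
          have := le_max_left ‖x‖ |t|
          have := le_max_right ‖x‖ |t|
          linarith
        have h3 : (3 * M)⁻¹ ≤ (1 + |t| + ‖x‖)⁻¹ := by gcongr
        calc C1 * M⁻¹ = 3 * C1 * (3 * M)⁻¹ := by field_simp
          _ ≤ _ := by gcongr
      calc ENNReal.ofReal ‖Kker ρ (2 * σ) x t‖
          ≤ ENNReal.ofReal ((3 * C1) * (1 + |t| + ‖x‖) ^ (-1 : ℝ)) := ENNReal.ofReal_le_ofReal k2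
        _ = ENNReal.ofReal (3 * C1) * ENNReal.ofReal (1 + |t| + ‖x‖) ^ (-1 : ℝ) := by
            rw [ENNReal.ofReal_mul (by positivity), ENNReal.ofReal_rpow_of_pos (by positivity)]
        _ ≤ _ := by
            gcongr
            · rw [add_assoc]; exact le_self_add
            · exact le_self_add
    · push Not at hM1
      have hx1 : ‖x‖ ≤ M := le_max_left _ _
      have ht1 : |t| ≤ M := le_max_right _ _
      have k1 := h2 x t h
      rw [← ofReal_norm]
      have ex : sing a x = ‖x‖ₑ ^ (-a) := by
        unfold sing
        exact Set.indicator_of_mem (by rw [mem_ball_zero_iff]; linarith) _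
      have et : sing b t = ‖t‖ₑ ^ (-b) := by
        unfold sing
        exact Set.indicator_of_mem (by rw [mem_ball_zero_iff, Real.norm_eq_abs]; linarith) _
      have l1 : ENNReal.ofReal M ^ (-a) ≤ ‖x‖ₑ ^ (-a) := by
        rw [ENNReal.rpow_neg, ENNReal.rpow_neg]
        gcongr
        rw [← ofReal_norm]; exact ENNReal.ofReal_le_ofReal hx1
      have l2 : ENNReal.ofReal M ^ (-b) ≤ ‖t‖ₑ ^ (-b) := by
        rw [ENNReal.rpow_neg, ENNReal.rpow_neg]
        gcongr
        rw [← ofReal_norm]; exact ENNReal.ofReal_le_ofReal ht1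
      calc ENNReal.ofReal ‖Kker ρ (2 * σ) x t‖
          ≤ ENNReal.ofReal (C2 * M ^ (-(a + b))) := ENNReal.ofReal_le_ofReal k1
        _ = ENNReal.ofReal C2 * (ENNReal.ofReal M ^ (-a) * ENNReal.ofReal M ^ (-b)) := by
            rw [ENNReal.ofReal_rpow_of_pos h, ENNReal.ofReal_rpow_of_pos h,
              ← ENNReal.ofReal_mul (by positivity), ← Real.rpow_add h,
              ENNReal.ofReal_mul (by positivity)]
            congr 3; ring
        _ ≤ ENNReal.ofReal C2 * (sing a x * sing b t) := by rw [ex, et]; gcongr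
        _ ≤ _ := by
            gcongr
            · rw [add_right_comm]; exact le_add_self
            · exact le_add_self

section loc
variable {E : Type*} [NormedAddCommGroup E]

lemma loc_pt {R l T : ℝ} (hR : 0 < R) (hl : 0 ≤ l) (hT : 1 ≤ T) (A : E → ℝ≥0∞) (β : ℝ≥0∞)
    (hA : ∀ x, x ∉ Metric.ball (0 : E) 2 → A x = 0) (v x : E) (hx : x ∈ Metric.ball v R) :
    ENNReal.ofReal (T + ‖x‖) ^ (-l) + A x * β ≤
      ENNReal.ofReal (1 + R) ^ l * ENNReal.ofReal (T + ‖v‖) ^ (-l) +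
        (Metric.ball (0 : E) (R + 2)).indicator (fun _ => β) v * A x := by
  classical
  rw [Metric.mem_ball, dist_eq_norm] at hx
  have hv : ‖v‖ ≤ ‖x‖ + R := by
    have := norm_sub_norm_le v x
    rw [norm_sub_rev] at this
    linarith
  refine add_le_add ?_ ?_
  · have hn := norm_nonneg x
    have hnv := norm_nonneg v
    rw [ENNReal.ofReal_rpow_of_pos (by linarith), ENNReal.ofReal_rpow_of_pos (by linarith),
      ENNReal.ofReal_rpow_of_pos (by linarith), ← ENNReal.ofReal_mul (by positivity)]
    refine ENNReal.ofReal_le_ofReal ?_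
    rw [Real.rpow_neg (by linarith), Real.rpow_neg (by linarith), ← div_eq_mul_inv,
      ← Real.div_rpow (by linarith) (by linarith), ← Real.inv_rpow (by linarith)]
    refine Real.rpow_le_rpow (by positivity) ?_ hl
    rw [inv_eq_one_div, div_le_div_iff₀ (by linarith) (by linarith)]
    nlinarith
  · by_cases hx2 : x ∈ Metric.ball (0 : E) 2
    · have : v ∈ Metric.ball (0 : E) (R + 2) := by
        rw [mem_ball_zero_iff] at *
        linarith
      rw [Set.indicator_of_mem this, mul_comm]
    · rw [hA x hx2]; simp

variable [NormedSpace ℝ E] [MeasurableSpace E] [BorelSpace E] [FiniteDimensional ℝ E]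

lemma loc_NP (μ : Measure E) [μ.IsAddHaarMeasure] {p R l : ℝ} (hp : 1 ≤ p) (hR : 0 < R)
    (hl : 0 ≤ l) : ∃ c : ℝ≥0∞, c ≠ ∞ ∧ ∀ (T : ℝ), 1 ≤ T → ∀ β : ℝ≥0∞, β ≠ ∞ →
      ∀ A : E → ℝ≥0∞, Measurable A → (∀ x, x ∉ Metric.ball (0 : E) 2 → A x = 0) → ∀ v : E,
      NP μ p ((Metric.ball v R).indicator (fun x => ENNReal.ofReal (T + ‖x‖) ^ (-l) + A x * β)) ≤
        c * ENNReal.ofReal (T + ‖v‖) ^ (-l) +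
          (Metric.ball (0 : E) (R + 2)).indicator (fun _ => β) v * NP μ p A := by
  classical
  have hp0 : 0 < p := by linarith
  refine ⟨ENNReal.ofReal (1 + R) ^ l * (μ (Metric.ball (0 : E) R)) ^ (1 / p),
    ENNReal.mul_ne_top (ENNReal.rpow_ne_top_of_nonneg hl (by simp))
      (ENNReal.rpow_ne_top_of_nonneg (by positivity) measure_ball_lt_top.ne), ?_⟩
  intro T hT β hβ A hAm hA v
  set c0 := ENNReal.ofReal (1 + R) ^ l * ENNReal.ofReal (T + ‖v‖) ^ (-l) with hc0
  set d0 := (Metric.ball (0 : E) (R + 2)).indicator (fun _ => β) v with hd0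
  have hc0t : c0 ≠ ∞ := by
    refine ENNReal.mul_ne_top (ENNReal.rpow_ne_top_of_nonneg hl (by simp))
      (ENNReal.rpow_ne_top_of_ne_zero ?_ (by simp))
    have := norm_nonneg v
    simp; linarith
  have hd0t : d0 ≠ ∞ := by
    rw [hd0, Set.indicator_apply]; split_ifs <;> simp [hβ]
  have hind : Measurable ((Metric.ball v R).indicator (fun _ : E => (1 : ℝ≥0∞))) :=
    measurable_const.indicator measurableSet_ball
  calc NP μ p ((Metric.ball v R).indicator (fun x => ENNReal.ofReal (T + ‖x‖) ^ (-l) + A x * β))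
      ≤ NP μ p (fun x => c0 * (Metric.ball v R).indicator (fun _ => 1) x + d0 * A x) := by
        refine NP_mono hp0 fun x => ?_
        by_cases hx : x ∈ Metric.ball v R
        · rw [Set.indicator_of_mem hx, Set.indicator_of_mem hx, mul_one]
          exact loc_pt hR hl hT A β hA v x hx
        · rw [Set.indicator_of_notMem hx]; exact zero_le
    _ ≤ NP μ p (fun x => c0 * (Metric.ball v R).indicator (fun _ => 1) x) +
        NP μ p (fun x => d0 * A x) :=
        NP_add_le hp (hind.const_mul _).aemeasurable (hAm.const_mul _).aemeasurable
    _ = c0 * (μ (Metric.ball (0 : E) R)) ^ (1 / p) + d0 * NP μ p A := by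
        rw [NP_const_mul hp0 hc0t, NP_const_mul hp0 hd0t]
        congr 2
        unfold NP
        congr 1
        rw [← Measure.addHaar_ball_center μ v R, ← lintegral_indicator_one measurableSet_ball]
        congr 1; ext x
        simp only [Set.indicator_apply]
        split_ifs <;> simp [hp0]
    _ = _ := by rw [hc0]; ring

lemma young_conv (μ : Measure E) [μ.IsAddHaarMeasure] {r r' : ℝ} (hr : 2 ≤ r)
    (hrr : r.HolderConjugate r') {Kt G : E → ℝ≥0∞} (hK : Measurable Kt) (hG : Measurable G) :
    NP μ r (fun y => ∫⁻ w, Kt (y - w) * G w ∂μ) ≤ NP μ (r / 2) Kt * NP μ r' G := by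
  have h := NP_young (μ := μ) (ν := μ) hr hrr (K := fun y w => Kt (y - w))
    (hK.comp (measurable_fst.sub measurable_snd)) hG (D := ∫⁻ x, Kt x ^ (r / 2) ∂μ)
    (fun x => (lintegral_sub_left_eq_self (fun y => Kt y ^ (r / 2)) x).le)
    (fun z => (lintegral_sub_right_eq_self (fun y => Kt y ^ (r / 2)) z).le)
  refine h.trans (le_of_eq ?_)
  unfold NP
  rw [one_div_div]
end loc

lemma LpE_mono' {α : Type*} [MeasurableSpace α] {μ : Measure α} (p : ℝ≥0∞)
    {f g : α → ℝ≥0∞} (h : ∀ x, f x ≤ g x) : LpE μ p f ≤ LpE μ p g := by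
  unfold LpE
  split_ifs
  · exact essSup_mono_ae (Filter.Eventually.of_forall h)
  · gcongr with x
    exact h x

lemma LpE_const_mul' {α : Type*} [MeasurableSpace α] {μ : Measure α} {p : ℝ≥0∞} (hp : p ≠ 0)
    {f : α → ℝ≥0∞} {c : ℝ≥0∞} (hc : c ≠ ∞) : LpE μ p (fun x => c * f x) = c * LpE μ p f := by
  unfold LpE
  split_ifs with h
  · exact ENNReal.essSup_const_mul
  · exact NP_const_mul (ENNReal.toReal_pos hp h) hc

lemma LpE_eq {α : Type*} [MeasurableSpace α] {μ : Measure α} {p : ℝ≥0∞} (hp : p ≠ ∞)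
    (f : α → ℝ≥0∞) : LpE μ p f = NP μ p.toReal f := by
  unfold LpE NP; rw [if_neg hp]

lemma NP_far_scale {T r : ℝ} (hT : 1 ≤ T) (hr : 6 < r) :
    NP (volume : Measure (EuclideanSpace ℝ (Fin 3))) (r / 2)
      (fun x => ENNReal.ofReal (T + ‖x‖) ^ (-1 : ℝ)) =
    ENNReal.ofReal T ^ (6 / r - 1) * NP (volume : Measure (EuclideanSpace ℝ (Fin 3))) (r / 2)
      (fun x => ENNReal.ofReal (1 + ‖x‖) ^ (-1 : ℝ)) := by
  have hT0 : 0 < T := by linarith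
  have hTe0 : ENNReal.ofReal T ≠ 0 := by simpa using hT0
  have hm : Measurable (fun x : EuclideanSpace ℝ (Fin 3) =>
      (ENNReal.ofReal (T + ‖x‖) ^ (-1 : ℝ)) ^ (r / 2)) := by fun_prop
  have hpt : ∀ x : EuclideanSpace ℝ (Fin 3),
      (ENNReal.ofReal (T + ‖T • x‖) ^ (-1 : ℝ)) ^ (r / 2) =
        ENNReal.ofReal T ^ (-(r / 2)) * (ENNReal.ofReal (1 + ‖x‖) ^ (-1 : ℝ)) ^ (r / 2) := by
    intro x
    rw [norm_smul, Real.norm_of_nonneg hT0.le, show T + T * ‖x‖ = T * (1 + ‖x‖) by ring,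
      ENNReal.ofReal_mul hT0.le, ENNReal.mul_rpow_of_ne_top (by simp) (by simp),
      ENNReal.mul_rpow_of_nonneg _ _ (by linarith), ← ENNReal.rpow_mul, neg_one_mul]
  unfold NP
  rw [lint_scale volume hT0 hm]
  simp_rw [hpt]
  rw [lintegral_const_mul _ (by fun_prop), ← mul_assoc,
    ← ENNReal.rpow_add _ _ hTe0 (by simp), ENNReal.mul_rpow_of_nonneg _ _ (by positivity),
    ← ENNReal.rpow_mul]
  congr 2
  simp
  field_simp
  ring

lemma NP_far_fin {r : ℝ} (hr : 6 < r) :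
    NP (volume : Measure (EuclideanSpace ℝ (Fin 3))) (r / 2)
      (fun x => ENNReal.ofReal (1 + ‖x‖) ^ (-1 : ℝ)) ≠ ∞ := by
  unfold NP
  refine ENNReal.rpow_ne_top_of_nonneg (by positivity) ?_
  refine ne_of_eq_of_ne ?_ (lint_far_rpow (volume : Measure (EuclideanSpace ℝ (Fin 3)))
    (s := r / 2) (by linarith) (by simp; linarith)).ne
  congr 1; ext x
  rw [← ENNReal.rpow_mul, neg_one_mul]

lemma x_part {ψ : EuclideanSpace ℝ (Fin 3) → ℝ} (hc : Continuous ψ) (hs : HasCompactSupport ψ)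
    (h0 : ∃ x, ψ x ≠ 0) {r r' rt rt' a : ℝ} (hr : 6 < r) (hrt : r ≤ rt)
    (hrr : r.HolderConjugate r') (hrrt : rt.HolderConjugate rt') (ha : 0 ≤ a) (ha' : a < 6 / rt) :
    ∃ C : ℝ≥0∞, C ≠ ∞ ∧ ∀ T : ℝ, 1 ≤ T → ∀ β : ℝ≥0∞, β ≠ ∞ →
      ∀ f : EuclideanSpace ℝ (Fin 3) → ℝ≥0∞, Measurable f →
      NP volume r (fun y => NP volume rt (fun x => (∫⁻ z, (ENNReal.ofReal (T + ‖x - z‖) ^ (-1 : ℝ) +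
        sing a (x - z) * β) * f z) * ‖ψ (x - y)‖₊)) ≤
      C * (ENNReal.ofReal T ^ (6 / r - 1) + β) *
        NP volume r' (fun y => NP volume rt' (fun x => f x * ‖ψ (x - y)‖₊)) := by
  classical
  obtain ⟨R, hR, C, hC, hAC⟩ := AC (volume : Measure (EuclideanSpace ℝ (Fin 3))) hc hs h0
  obtain ⟨c, hcf, hloc⟩ := loc_NP (volume : Measure (EuclideanSpace ℝ (Fin 3))) (p := rt / 2)
    (R := R) (l := 1) (by linarith) hR zero_le_one
  set N := NP (volume : Measure (EuclideanSpace ℝ (Fin 3))) (rt / 2) (sing a) with hN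
  have hNf : N ≠ ∞ := sing_NP volume (by simp) ha (by linarith) (by
    rw [lt_div_iff₀ (by linarith)] at ha'
    simp; linarith)
  set N2 := NP (volume : Measure (EuclideanSpace ℝ (Fin 3))) (r / 2)
      (fun x => ENNReal.ofReal (1 + ‖x‖) ^ (-1 : ℝ)) with hN2
  have hN2f : N2 ≠ ∞ := NP_far_fin hr
  set ind : EuclideanSpace ℝ (Fin 3) → ℝ≥0∞ :=
    (Metric.ball (0 : EuclideanSpace ℝ (Fin 3)) (R + 2)).indicator (fun _ => 1) with hind
  have hindm : Measurable ind := measurable_const.indicator measurableSet_ball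
  set N3 := NP (volume : Measure (EuclideanSpace ℝ (Fin 3))) (r / 2) ind with hN3
  have hN3f : N3 ≠ ∞ := by
    rw [hN3]
    unfold NP
    refine ENNReal.rpow_ne_top_of_nonneg (by positivity) ?_
    refine ne_of_eq_of_ne ?_ (measure_ball_lt_top
      (μ := (volume : Measure (EuclideanSpace ℝ (Fin 3)))) (x := 0) (r := R + 2)).ne
    rw [← lintegral_indicator_one measurableSet_ball]
    congr 1; ext x
    simp only [hind, Set.indicator_apply]
    split_ifs <;> simp <;> linarith
  refine ⟨C * (c * N2 + N * N3), ENNReal.mul_ne_top hC (ENNReal.add_ne_top.2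
    ⟨ENNReal.mul_ne_top hcf hN2f, ENNReal.mul_ne_top hNf hN3f⟩), ?_⟩
  intro T hT β hβ f hf
  set Kt : EuclideanSpace ℝ (Fin 3) → ℝ≥0∞ := fun v =>
    c * ENNReal.ofReal (T + ‖v‖) ^ (-1 : ℝ) + (β * N) * ind v with hKt
  have hm1 : Measurable (fun v : EuclideanSpace ℝ (Fin 3) => ENNReal.ofReal (T + ‖v‖) ^ (-1 : ℝ)) := by
    fun_prop
  have hKtm : Measurable Kt := (hm1.const_mul c).add (hindm.const_mul _)
  have hKtN : NP volume (r / 2) Kt ≤ (c * N2 + N * N3) * (ENNReal.ofReal T ^ (6 / r - 1) + β) := by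
    calc NP volume (r / 2) Kt ≤ NP volume (r / 2) (fun v : EuclideanSpace ℝ (Fin 3) =>
            c * ENNReal.ofReal (T + ‖v‖) ^ (-1 : ℝ)) +
          NP volume (r / 2) (fun v => (β * N) * ind v) :=
          NP_add_le (by linarith) (hm1.const_mul c).aemeasurable (hindm.const_mul _).aemeasurable
      _ = c * (ENNReal.ofReal T ^ (6 / r - 1) * N2) + β * N * N3 := by
          rw [NP_const_mul (by linarith) hcf, NP_const_mul (by linarith) (ENNReal.mul_ne_top hβ hNf),
            NP_far_scale hT hr]
      _ = (c * N2) * ENNReal.ofReal T ^ (6 / r - 1) + (N * N3) * β := by ring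
      _ ≤ (c * N2 + N * N3) * ENNReal.ofReal T ^ (6 / r - 1) + (c * N2 + N * N3) * β := by
          gcongr
          · exact le_self_add
          · exact le_add_self
      _ = _ := by ring
  have hκm : Measurable (fun x : EuclideanSpace ℝ (Fin 3) =>
      ENNReal.ofReal (T + ‖x‖) ^ (-1 : ℝ) + sing a x * β) :=
    hm1.add ((sing_meas a).mul_const β)
  have hmain := (hAC r r' (by linarith) hrr.symm.pos _ Kt f (NP volume (r / 2) Kt) hκm hKtm hf
    (fun G hG => young_conv volume (by linarith) hrr hKtm hG)).1 rt rt' (by linarith) hrrt (by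
      intro v
      refine (hloc T hT β hβ (sing a) (sing_meas a) (sing_out a) v).trans (le_of_eq ?_)
      simp only [hKt, hind, Set.indicator_apply]
      split_ifs <;> simp [hN])
  refine hmain.trans ?_
  rw [mul_assoc C (c * N2 + N * N3)]
  gcongr

lemma t_part {φ : ℝ → ℝ} (hc : Continuous φ) (hs : HasCompactSupport φ)
    (h0 : ∃ x, φ x ≠ 0) {q q' b : ℝ} {qt qt' : ℝ≥0∞} (hq : 2 < q) (hqq : q.HolderConjugate q')
    (hqt : 2 ≤ qt) (hqt' : qt⁻¹ + qt'⁻¹ = 1) (hb : 0 ≤ b)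
    (hb' : b = 0 ∨ b < 2 * (qt⁻¹).toReal) :
    ∃ C : ℝ≥0∞, C ≠ ∞ ∧ ∀ f : ℝ → ℝ≥0∞, Measurable f →
      NP volume q (fun s => LpE volume qt (fun t => (∫⁻ u, (ENNReal.ofReal (1 + ‖t - u‖) ^ (-(2 / q)) +
        sing b (t - u)) * f u) * ‖φ (t - s)‖₊)) ≤
      C * NP volume q' (fun s => LpE volume qt' (fun t => f t * ‖φ (t - s)‖₊)) := by
  classical
  obtain ⟨R, hR, C, hC, hAC⟩ := AC (volume : Measure ℝ) hc hs h0
  have hl0 : 0 < 2 / q := by positivity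
  have hl1 : 2 / q < 1 := by rw [div_lt_one (by linarith)]; exact hq
  obtain ⟨c, hcf, hH⟩ := hls hl0 hl1 (q := q) (by field_simp) hqq.symm
  set l := 2 / q with hl
  have hκm : Measurable (fun x : ℝ => ENNReal.ofReal (1 + ‖x‖) ^ (-l) + sing b x) :=
    (by fun_prop : Measurable (fun x : ℝ => ENNReal.ofReal (1 + ‖x‖) ^ (-l))).add (sing_meas b)
  -- absorbing the compactly supported part
  have habs : ∀ v : ℝ, (Metric.ball (0 : ℝ) (R + 2)).indicator (fun _ => (1 : ℝ≥0∞)) v ≤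
      ENNReal.ofReal (R + 3) ^ l * ENNReal.ofReal (1 + ‖v‖) ^ (-l) := by
    intro v
    simp only [Set.indicator_apply]
    split_ifs with hv
    · rw [mem_ball_zero_iff] at hv
      have hn := norm_nonneg v
      rw [ENNReal.ofReal_rpow_of_pos (by linarith), ENNReal.ofReal_rpow_of_pos (by linarith),
        ← ENNReal.ofReal_mul (by positivity), ENNReal.one_le_ofReal, Real.rpow_neg (by linarith),
        ← div_eq_mul_inv, ← Real.div_rpow (by linarith) (by linarith)]
      refine Real.one_le_rpow ?_ hl0.le
      rw [one_le_div (by linarith)]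
      linarith
    · exact zero_le
  have hfar : ∀ v : ℝ, ENNReal.ofReal (1 + ‖v‖) ^ (-l) ≤ ‖v‖ₑ ^ (-l) := by
    intro v
    rw [ENNReal.rpow_neg, ENNReal.rpow_neg]
    gcongr
    rw [← ofReal_norm]
    exact ENNReal.ofReal_le_ofReal (by linarith)
  have hconv : ∀ D : ℝ≥0∞, D ≠ ∞ → ∀ G : ℝ → ℝ≥0∞, Measurable G →
      NP volume q (fun y => ∫⁻ w, (D * ‖y - w‖ₑ ^ (-l)) * G w) ≤ (D * c) * NP volume q' G := by
    intro D hD G hG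
    have e1 : (fun y : ℝ => ∫⁻ w, (D * ‖y - w‖ₑ ^ (-l)) * G w) =
        fun y => D * ∫⁻ w, ‖y - w‖ₑ ^ (-l) * G w := by
      ext y
      rw [← lintegral_const_mul' _ _ hD]
      congr 1; ext w; ring
    rw [e1, NP_const_mul (by linarith) hD, mul_assoc]
    gcongr
    exact hH G hG
  have hKtm : ∀ D : ℝ≥0∞, Measurable (fun v : ℝ => D * ‖v‖ₑ ^ (-l)) := fun D => by fun_prop
  by_cases htop : qt = ∞
  · have hb0 : b = 0 := by
      rcases hb' with h | h
      · exact h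
      · rw [htop] at h; simp at h; linarith
    have hqt1 : qt' = 1 := by
      rw [htop] at hqt'
      simpa using hqt'
    set D : ℝ≥0∞ := ENNReal.ofReal (1 + R) ^ l + ENNReal.ofReal (R + 3) ^ l with hD
    have hDf : D ≠ ∞ := ENNReal.add_ne_top.2 ⟨ENNReal.rpow_ne_top_of_nonneg hl0.le (by simp),
      ENNReal.rpow_ne_top_of_nonneg hl0.le (by simp)⟩
    refine ⟨C * (D * c), ENNReal.mul_ne_top hC (ENNReal.mul_ne_top hDf hcf), ?_⟩
    intro f hf
    have hmain := (hAC q q' (by linarith) hqq.symm.pos _ (fun v => D * ‖v‖ₑ ^ (-l)) f (D * c)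
      hκm (hKtm D) hf (hconv D hDf)).2 (by
        intro v x hx
        have := loc_pt hR hl0.le le_rfl (sing b) 1 (sing_out b) v x hx
        rw [mul_one] at this
        refine this.trans ?_
        calc _ ≤ ENNReal.ofReal (1 + R) ^ l * ENNReal.ofReal (1 + ‖v‖) ^ (-l) +
              (ENNReal.ofReal (R + 3) ^ l * ENNReal.ofReal (1 + ‖v‖) ^ (-l)) * 1 := by
              gcongr
              · exact habs v
              · rw [hb0]; exact sing_zero_le x
          _ = D * ENNReal.ofReal (1 + ‖v‖) ^ (-l) := by rw [hD]; ring
          _ ≤ _ := mul_le_mul_right (hfar v) D)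
    have e1 : ∀ g : ℝ → ℝ≥0∞, LpE volume qt g = essSup g volume := fun g => by
      unfold LpE; rw [if_pos htop]
    have e2 : ∀ g : ℝ → ℝ≥0∞, LpE volume qt' g = NP volume 1 g := fun g => by
      rw [LpE_eq (by simp [hqt1]), hqt1]; simp
    simp only [e1, e2]
    exact hmain
  · set p := qt.toReal with hp
    have hp2 : 2 ≤ p := by
      have := (ENNReal.toReal_le_toReal (by simp) htop).2 hqt
      simpa using this
    have hqt0 : qt ≠ 0 := by rintro rfl; simp at hqt
    have hinv : qt⁻¹ ≠ ∞ := by simpa using hqt0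
    have hinv' : qt'⁻¹ ≠ ∞ := by
      intro h; rw [h] at hqt'; simp at hqt'
    have hsum : p⁻¹ + (qt'.toReal)⁻¹ = 1 := by
      have := congrArg ENNReal.toReal hqt'
      rw [ENNReal.toReal_add hinv hinv', ENNReal.toReal_inv, ENNReal.toReal_inv] at this
      simpa using this
    have hqt'top : qt' ≠ ∞ := by
      rintro rfl
      simp at hsum
      rw [hsum] at hp2
      norm_num at hp2
    have hpp : p.HolderConjugate qt'.toReal := by
      rw [Real.holderConjugate_iff]
      exact ⟨by linarith, hsum⟩
    obtain ⟨c2, hc2f, hloc⟩ := loc_NP (volume : Measure ℝ) (p := p / 2)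
      (R := R) (l := l) (by linarith) hR hl0.le
    set N := NP (volume : Measure ℝ) (p / 2) (sing b) with hN
    have hNf : N ≠ ∞ := sing_NP volume (by simp) hb (by linarith) (by
      simp only [Module.finrank_self, Nat.cast_one]
      rcases hb' with h | h
      · rw [h]; simp
      · rw [ENNReal.toReal_inv] at h
        have h2 : (0 : ℝ) < p := by linarith
        calc b * (p / 2) < 2 * p⁻¹ * (p / 2) := by gcongr
          _ = 1 := by field_simp)
    set D : ℝ≥0∞ := c2 + ENNReal.ofReal (R + 3) ^ l * N with hD
    have hDf : D ≠ ∞ := ENNReal.add_ne_top.2 ⟨hc2f,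
      ENNReal.mul_ne_top (ENNReal.rpow_ne_top_of_nonneg hl0.le (by simp)) hNf⟩
    refine ⟨C * (D * c), ENNReal.mul_ne_top hC (ENNReal.mul_ne_top hDf hcf), ?_⟩
    intro f hf
    have hmain := (hAC q q' (by linarith) hqq.symm.pos _ (fun v => D * ‖v‖ₑ ^ (-l)) f (D * c)
      hκm (hKtm D) hf (hconv D hDf)).1 p qt'.toReal hp2 hpp (by
        intro v
        have := hloc 1 le_rfl 1 (by simp) (sing b) (sing_meas b) (sing_out b) v
        simp only [mul_one] at this
        refine this.trans ?_
        calc _ ≤ c2 * ENNReal.ofReal (1 + ‖v‖) ^ (-l) +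
              (ENNReal.ofReal (R + 3) ^ l * ENNReal.ofReal (1 + ‖v‖) ^ (-l)) * N := by
              gcongr
              exact habs v
          _ = D * ENNReal.ofReal (1 + ‖v‖) ^ (-l) := by rw [hD]; ring
          _ ≤ _ := mul_le_mul_right (hfar v) D)
    simp only [LpE_eq htop, LpE_eq hqt'top]
    exact hmain

lemma conv_meas {κ : ℝ → EuclideanSpace ℝ (Fin 3) → ℝ≥0∞}
    (hκm : Measurable (fun p : ℝ × EuclideanSpace ℝ (Fin 3) => κ p.1 p.2))
    {Φ : EuclideanSpace ℝ (Fin 3) × ℝ → ℝ≥0∞} (hΦ : Measurable Φ) (t : ℝ) :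
    Measurable (fun p : EuclideanSpace ℝ (Fin 3) × ℝ =>
      ∫⁻ z, κ (t - p.2) (p.1 - z) * Φ (z, p.2)) := by
  have h1 : Measurable (fun p : (EuclideanSpace ℝ (Fin 3) × ℝ) × EuclideanSpace ℝ (Fin 3) =>
      κ (t - p.1.2) (p.1.1 - p.2)) := by
    have h3 : Measurable (fun p : (EuclideanSpace ℝ (Fin 3) × ℝ) × EuclideanSpace ℝ (Fin 3) =>
      (t - p.1.2, p.1.1 - p.2)) := by fun_prop
    exact hκm.comp h3
  have h2 : Measurable (fun p : (EuclideanSpace ℝ (Fin 3) × ℝ) × EuclideanSpace ℝ (Fin 3) =>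
      Φ (p.2, p.1.2)) := by
    have h3 : Measurable (fun p : (EuclideanSpace ℝ (Fin 3) × ℝ) × EuclideanSpace ℝ (Fin 3) =>
      (p.2, p.1.2)) := by fun_prop
    exact hΦ.comp h3
  exact Measurable.lintegral_prod_right (f := fun (p : EuclideanSpace ℝ (Fin 3) × ℝ) z =>
        κ (t - p.2) (p.1 - z) * Φ (z, p.2)) (h1.mul h2)

lemma win_meas {ψ : EuclideanSpace ℝ (Fin 3) → ℝ} (hψm : Measurable ψ)
    {h : EuclideanSpace ℝ (Fin 3) × ℝ → ℝ≥0∞} (hh : Measurable h) :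
    Measurable (fun p : EuclideanSpace ℝ (Fin 3) × (EuclideanSpace ℝ (Fin 3) × ℝ) =>
        h (p.1, p.2.2) * (‖ψ (p.1 - p.2.1)‖₊ : ℝ≥0∞)) := by
  have h1 : Measurable (fun p : EuclideanSpace ℝ (Fin 3) × (EuclideanSpace ℝ (Fin 3) × ℝ) =>
      (p.1, p.2.2)) := by fun_prop
  have h2 : Measurable (fun p : EuclideanSpace ℝ (Fin 3) × (EuclideanSpace ℝ (Fin 3) × ℝ) =>
      ψ (p.1 - p.2.1)) := by fun_prop
  exact (hh.comp h1).mul h2.nnnorm.coe_nnreal_ennreal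

lemma win_NP_meas {ψ : EuclideanSpace ℝ (Fin 3) → ℝ} (hψm : Measurable ψ)
    {h : EuclideanSpace ℝ (Fin 3) × ℝ → ℝ≥0∞} (hh : Measurable h) (rt : ℝ) :
    Measurable (fun p : EuclideanSpace ℝ (Fin 3) × ℝ => NP volume rt (fun x =>
        h (x, p.2) * (‖ψ (x - p.1)‖₊ : ℝ≥0∞))) :=
  NP_measurable (μ := volume) (f := fun x (p : EuclideanSpace ℝ (Fin 3) × ℝ) =>
    h (x, p.2) * (‖ψ (x - p.1)‖₊ : ℝ≥0∞)) (win_meas hψm hh)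

lemma wa_mink {ψ : EuclideanSpace ℝ (Fin 3) → ℝ} (hψm : Measurable ψ) {r rt : ℝ} (hr : 1 ≤ r)
    (hrt : 1 ≤ rt) {h : EuclideanSpace ℝ (Fin 3) × ℝ → ℝ≥0∞} (hh : Measurable h) :
    NP volume r (fun y => NP volume rt (fun x => (∫⁻ s, h (x, s)) * (‖ψ (x - y)‖₊ : ℝ≥0∞))) ≤
      ∫⁻ s, NP volume r (fun y => NP volume rt (fun x => h (x, s) * (‖ψ (x - y)‖₊ : ℝ≥0∞))) := by
  calc _ ≤ NP volume r (fun y => ∫⁻ s, NP volume rt (fun x =>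
            h (x, s) * (‖ψ (x - y)‖₊ : ℝ≥0∞))) := by
          refine NP_mono (by linarith) fun y => ?_
          have e : (fun x => (∫⁻ s, h (x, s)) * (‖ψ (x - y)‖₊ : ℝ≥0∞)) =
              fun x => ∫⁻ s, h (x, s) * (‖ψ (x - y)‖₊ : ℝ≥0∞) := by
            ext x
            rw [lintegral_mul_const' _ _ (by simp)]
          rw [e]
          have hm : Measurable (fun p : EuclideanSpace ℝ (Fin 3) × ℝ =>
              (p.1, (y, p.2))) := by fun_prop
          exact NP_minkowski hrt (f := fun x s => h (x, s) * (‖ψ (x - y)‖₊ : ℝ≥0∞))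
            ((win_meas hψm hh).comp hm)
    _ ≤ _ := NP_minkowski hr (f := fun y s => NP volume rt (fun x =>
            h (x, s) * (‖ψ (x - y)‖₊ : ℝ≥0∞))) (win_NP_meas hψm hh rt)

lemma wa_const {ψ : EuclideanSpace ℝ (Fin 3) → ℝ} {r rt : ℝ} (hr : 1 ≤ r)
    (hrt : 1 ≤ rt) {C0 : ℝ≥0∞} (hC0 : C0 ≠ ∞) {g h : EuclideanSpace ℝ (Fin 3) → ℝ≥0∞}
    (hg : ∀ x, g x ≤ C0 * h x) :
    NP volume r (fun y => NP volume rt (fun x => g x * (‖ψ (x - y)‖₊ : ℝ≥0∞))) ≤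
      C0 * NP volume r (fun y => NP volume rt (fun x => h x * (‖ψ (x - y)‖₊ : ℝ≥0∞))) := by
  calc _ ≤ NP volume r (fun y => NP volume rt (fun x =>
            C0 * (h x * (‖ψ (x - y)‖₊ : ℝ≥0∞)))) := by
          refine NP_mono (by linarith) fun y => NP_mono (by linarith) fun x => ?_
          rw [← mul_assoc]
          exact mul_le_mul_left (hg x) _
    _ = _ := by
          rw [← NP_const_mul (by linarith) hC0]
          congr 1; ext y
          rw [NP_const_mul (by linarith) hC0]

lemma wa_bound {ψ : EuclideanSpace ℝ (Fin 3) → ℝ} (hψm : Measurable ψ) {r rt : ℝ} (hr : 1 ≤ r)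
    (hrt : 1 ≤ rt) {κ : ℝ → EuclideanSpace ℝ (Fin 3) → ℝ≥0∞}
    (hκm : Measurable (fun p : ℝ × EuclideanSpace ℝ (Fin 3) => κ p.1 p.2))
    {K : EuclideanSpace ℝ (Fin 3) → ℝ → ℂ} {F : EuclideanSpace ℝ (Fin 3) × ℝ → ℂ}
    (hF : Measurable F) {C0 Cx : ℝ≥0∞} (hC0 : C0 ≠ ∞) (hCx : Cx ≠ ∞)
    (hK : ∀ x t, ‖K x t‖ₑ ≤ C0 * κ t x) (m w : ℝ → ℝ≥0∞) (t : ℝ)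
    (hX : ∀ s, s ≠ t → NP volume r (fun y => NP volume rt (fun x =>
      (∫⁻ z, κ (t - s) (x - z) * (‖F (z, s)‖₊ : ℝ≥0∞)) * (‖ψ (x - y)‖₊ : ℝ≥0∞))) ≤
      Cx * (m (t - s) * w s)) :
    NP volume r (fun y => NP volume rt (fun x => (‖∫ s : ℝ, ∫ z : EuclideanSpace ℝ (Fin 3),
            K (x - z) (t - s) * F (z, s)‖₊ : ℝ≥0∞) * (‖ψ (x - y)‖₊ : ℝ≥0∞))) ≤
      (C0 * Cx) * ∫⁻ s, m (t - s) * w s := by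
  have hFm : Measurable (fun p : EuclideanSpace ℝ (Fin 3) × ℝ => (‖F p‖₊ : ℝ≥0∞)) := by fun_prop
  have hpt : ∀ x, (‖∫ s : ℝ, ∫ z : EuclideanSpace ℝ (Fin 3),
      K (x - z) (t - s) * F (z, s)‖₊ : ℝ≥0∞) ≤
        C0 * ∫⁻ s, ∫⁻ z, κ (t - s) (x - z) * (‖F (z, s)‖₊ : ℝ≥0∞) := by
    intro x
    rw [← lintegral_const_mul' _ _ hC0]
    refine (enorm_integral_le_lintegral_enorm _).trans (lintegral_mono fun s => ?_)
    refine (enorm_integral_le_lintegral_enorm _).trans ?_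
    rw [← lintegral_const_mul' _ _ hC0]
    refine lintegral_mono fun z => ?_
    rw [enorm_mul, ← mul_assoc]
    exact mul_le_mul_left (hK (x - z) (t - s)) _
  refine (wa_const hr hrt hC0 hpt).trans ?_
  rw [mul_assoc]
  refine mul_le_mul_right ?_ _
  refine (wa_mink hψm hr hrt (conv_meas hκm hFm t)).trans ?_
  rw [← lintegral_const_mul' _ _ hCx]
  refine lintegral_mono_ae ?_
  have hne : ∀ᵐ s : ℝ, s ≠ t := by
    rw [ae_iff]; simp
  filter_upwards [hne] with s hs
  exact hX s hs

lemma t_final {φ : ℝ → ℝ} {q : ℝ} {qt : ℝ≥0∞} (hq : 2 < q) (hqt0 : qt ≠ 0) {c : ℝ≥0∞} (hc : c ≠ ∞)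
    {U V : ℝ → ℝ≥0∞} (h : ∀ t, U t ≤ c * V t) :
    NP volume q (fun s => LpE volume qt (fun t => U t * (‖φ (t - s)‖₊ : ℝ≥0∞))) ≤
    c * NP volume q (fun s => LpE volume qt (fun t => V t * (‖φ (t - s)‖₊ : ℝ≥0∞))) := by
  calc _ ≤ NP volume q (fun s => LpE volume qt (fun t => c * (V t * (‖φ (t - s)‖₊ : ℝ≥0∞)))) := by
        refine NP_mono (by linarith) fun s => LpE_mono' _ fun t => ?_
        rw [← mul_assoc]
        exact mul_le_mul_left (h t) _
    _ = _ := by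
        rw [← NP_const_mul (by linarith) hc]
        congr 1; ext s
        rw [LpE_const_mul' hqt0 hc]

theorem Kker_TTstar (σ : ℝ) (hσ : 1 < σ) (qt : ℝ≥0∞) (hqt : 2 ≤ qt)
    (q r rt : ℝ) (hq : 2 < q) (hr6 : 6 < r) (hrrt : r ≤ rt)
    (hcond1 : (qt⁻¹).toReal + 3 / rt > 3 / 2 - σ) (hcond2 : 1 / q + 3 / r = 1 / 2)
    (qt' : ℝ≥0∞) (hqt' : qt⁻¹ + qt'⁻¹ = 1)
    (q' rt' r' : ℝ) (hq' : 1 / q + 1 / q' = 1) (hrt' : 1 / rt + 1 / rt' = 1)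
    (hr' : 1 / r + 1 / r' = 1)
    (ρ : ℝ → ℝ)
    (hρ : ContDiff ℝ (⊤ : ℕ∞) ρ) (hρsupp : Function.support ρ ⊆ Set.Ioo (-2) 2)
    (hρ1 : ∀ s : ℝ, |s| ≤ 1 → ρ s = 1)
    (ψ : EuclideanSpace ℝ (Fin 3) → ℝ) (hψ : ContDiff ℝ (⊤ : ℕ∞) ψ)
    (hψc : HasCompactSupport ψ) (hψne : ψ ≠ 0)
    (φ : ℝ → ℝ) (hφ : ContDiff ℝ (⊤ : ℕ∞) φ) (hφc : HasCompactSupport φ) (hφne : φ ≠ 0) :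
    ∃ C : ℝ, 0 < C ∧ ∀ F : SchwartzMap (EuclideanSpace ℝ (Fin 3) × ℝ) ℂ,
      WAmix ψ φ qt (ENNReal.ofReal q) (ENNReal.ofReal rt) (ENNReal.ofReal r)
          (fun p => ∫ s : ℝ, ∫ z : EuclideanSpace ℝ (Fin 3),
            Kker ρ (2 * σ) (p.1 - z) (p.2 - s) * F (z, s))
        ≤ ENNReal.ofReal C *
          WAmix ψ φ qt' (ENNReal.ofReal q') (ENNReal.ofReal rt') (ENNReal.ofReal r')
            (fun p => F p) := by
  classical
  have hE : ∃ x, ψ x ≠ 0 := by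
    by_contra h
    push Not at h
    exact hψne (funext h)
  have hE' : ∃ x, φ x ≠ 0 := by
    by_contra h
    push Not at h
    exact hφne (funext h)
  have hqq : q.HolderConjugate q' := by
    rw [Real.holderConjugate_iff]; exact ⟨by linarith, by simpa using hq'⟩
  have hrr : r.HolderConjugate r' := by
    rw [Real.holderConjugate_iff]; exact ⟨by linarith, by simpa using hr'⟩
  have hrrt' : rt.HolderConjugate rt' := by
    rw [Real.holderConjugate_iff]; exact ⟨by linarith, by simpa using hrt'⟩
  obtain ⟨a, b, ha, hb, ha6, hbQ, hab, habσ⟩ := exps hσ (by linarith : 6 < rt) hcond1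
  obtain ⟨C0, hC0, hmaj⟩ := majorant hσ ρ hρ hρsupp hρ1 ha hb hab habσ
  obtain ⟨Cx, hCx, hX⟩ := x_part hψ.continuous hψc hE hr6 hrrt hrr hrrt' ha ha6
  obtain ⟨Ct, hCt, hT⟩ := t_part hφ.continuous hφc hE' hq hqq hqt hqt' hb hbQ
  have hexp : 6 / r - 1 = -(2 / q) := by
    have e1 : 6 / r = 2 * (3 / r) := by ring
    have e2 : 2 / q = 2 * (1 / q) := by ring
    rw [e1, e2]; linarith
  have hqt0 : qt ≠ 0 := by rintro rfl; simp at hqt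
  set Cf : ℝ≥0∞ := C0 * Cx * Ct with hCf
  have hCff : Cf ≠ ∞ := ENNReal.mul_ne_top (ENNReal.mul_ne_top hC0 hCx) hCt
  refine ⟨Cf.toReal + 1, by positivity, ?_⟩
  intro F
  have hCle : Cf ≤ ENNReal.ofReal (Cf.toReal + 1) := by
    rw [ENNReal.ofReal_add (by positivity) (by norm_num), ENNReal.ofReal_toReal hCff]
    exact le_self_add
  refine le_trans ?_ (mul_le_mul_left hCle _)
  have hFm : Measurable (F : EuclideanSpace ℝ (Fin 3) × ℝ → ℂ) := F.continuous.measurable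
  have hFn : Measurable (fun p : EuclideanSpace ℝ (Fin 3) × ℝ => (‖F p‖₊ : ℝ≥0∞)) :=
    hFm.nnnorm.coe_nnreal_ennreal
  have hψm : Measurable ψ := hψ.continuous.measurable
  have hr'0 : 0 < r' := hrr.symm.pos
  have hq'0 : 0 < q' := hqq.symm.pos
  have hrt'0 : 0 < rt' := hrrt'.symm.pos
  have hκm : Measurable (fun p : ℝ × EuclideanSpace ℝ (Fin 3) =>
      ENNReal.ofReal (1 + |p.1| + ‖p.2‖) ^ (-1 : ℝ) + sing a p.2 * sing b p.1) := by
    have h1 : Measurable (fun p : ℝ × EuclideanSpace ℝ (Fin 3) =>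
      ENNReal.ofReal (1 + |p.1| + ‖p.2‖) ^ (-1 : ℝ)) := by fun_prop
    have h2 : Measurable (fun p : ℝ × EuclideanSpace ℝ (Fin 3) => sing a p.2) :=
      (sing_meas a).comp measurable_snd
    have h3 : Measurable (fun p : ℝ × EuclideanSpace ℝ (Fin 3) => sing b p.1) :=
      (sing_meas b).comp measurable_fst
    exact h1.add (h2.mul h3)
  obtain ⟨w, hw⟩ : ∃ w : ℝ → ℝ≥0∞, w = fun s => NP volume r' (fun y => NP volume rt'
    (fun x => (‖F (x, s)‖₊ : ℝ≥0∞) * ‖ψ (x - y)‖₊)) := ⟨_, rfl⟩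
  have hwm : Measurable w := by
    rw [hw]
    exact NP_measurable (μ := volume) (f := fun y s => NP volume rt'
      (fun x => (‖F (x, s)‖₊ : ℝ≥0∞) * ‖ψ (x - y)‖₊)) (win_NP_meas hψm hFn rt')
  have hWA : ∀ t : ℝ, NP volume r (fun y => NP volume rt (fun x =>
      (‖∫ s : ℝ, ∫ z : EuclideanSpace ℝ (Fin 3),
            Kker ρ (2 * σ) (x - z) (t - s) * F (z, s)‖₊ : ℝ≥0∞) * (‖ψ (x - y)‖₊ : ℝ≥0∞))) ≤
      (C0 * Cx) * ∫⁻ s, (ENNReal.ofReal (1 + ‖t - s‖) ^ (-(2 / q)) + sing b (t - s)) * w s := by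
    intro t
    refine wa_bound hψm (by linarith) (by linarith)
      (κ := fun τ x => ENNReal.ofReal (1 + |τ| + ‖x‖) ^ (-1 : ℝ) + sing a x * sing b τ)
      (K := Kker ρ (2 * σ)) hκm hFm hC0 hCx hmaj
      (fun τ => ENNReal.ofReal (1 + ‖τ‖) ^ (-(2 / q)) + sing b τ) w t ?_
    intro s hs
    have hβ : sing b (t - s) ≠ ∞ := sing_ne_top b _ (sub_ne_zero.2 (Ne.symm hs))
    have hFs : Measurable (fun z => (‖F (z, s)‖₊ : ℝ≥0∞)) :=
      hFn.comp (measurable_id.prodMk measurable_const)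
    have h5 := hX (1 + |t - s|) (by linarith [abs_nonneg (t - s)]) (sing b (t - s)) hβ
      (fun z => (‖F (z, s)‖₊ : ℝ≥0∞)) hFs
    rw [hexp, mul_assoc] at h5
    rw [hw]
    exact h5
  have hR : WAmix ψ φ qt' (ENNReal.ofReal q') (ENNReal.ofReal rt') (ENNReal.ofReal r')
            (fun p => F p) =
      NP volume q' (fun s => LpE volume qt' (fun t => w t * ‖φ (t - s)‖₊)) := by
    unfold WAmix WAx
    simp only [LpE_ofReal hr'0.le, LpE_ofReal hrt'0.le, LpE_ofReal hq'0.le, hw]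
  rw [hR]
  unfold WAmix WAx
  simp only [LpE_ofReal (by linarith : 0 ≤ q), LpE_ofReal (by linarith : 0 ≤ r),
    LpE_ofReal (by linarith : 0 ≤ rt)]
  refine (t_final hq hqt0 (ENNReal.mul_ne_top hC0 hCx) hWA).trans ?_
  rw [hCf, mul_assoc (C0 * Cx)]
  exact mul_le_mul_right (hT w hwm) _

end
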